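/- arXiv:1710.05347 — 3 statements merged into one kernel-verified Lean document; each statement's English description precedes it below -/
import Mathlib

section
/- Let r and k be integers with 0 ≤ k ≤ r−1, and let H be the r-uniform hypergraph consisting of exactly two edges whose intersection has exactly k vertices. If n ≥ 2r−k, then φ_H^r(n) = ⌈(1/2)·C(n,r)⌉, where C(n,r) is the binomial coefficient n choose r. -/
/-- A decomposition of the edge set `G` of an `r`-graph into parts `P`, where each part is
either a single edge or a copy of the `r`-graph `H` consisting of two edges intersecting
in exactly `k` vertices. -/
def IsPairDecomp (k : ℕ) {n : ℕ} (G : Finset (Finset (Fin n)))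
    (P : Finset (Finset (Finset (Fin n)))) : Prop :=
  (∀ p ∈ P, ∀ q ∈ P, p ≠ q → Disjoint p q) ∧
    P.biUnion id = G ∧
    ∀ p ∈ P, (∃ e, p = {e}) ∨
      ∃ e f : Finset (Fin n), e ≠ f ∧ (e ∩ f).card = k ∧ p = {e, f}

/-- `φ_H^r(G)`: the minimum number of parts in an `H`-decomposition of `G`, where `H`
consists of two edges intersecting in exactly `k` vertices. -/
noncomputable def phiPair (k : ℕ) {n : ℕ} (G : Finset (Finset (Fin n))) : ℕ :=
  sInf {m | ∃ P, IsPairDecomp k G P ∧ P.card = m}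

/-- `φ_H^r(n)`: the maximum of `φ_H^r(G)` over all `r`-graphs `G` on `n` vertices. -/
noncomputable def phiPairMax (r k n : ℕ) : ℕ :=
  sSup {m | ∃ G : Finset (Finset (Fin n)), (∀ e ∈ G, e.card = r) ∧ phiPair k G = m}

/-- A matching of `G`, encoded as the involution exchanging matched vertices and fixing the
unmatched ones. -/
def IsMatchingInvolution {V : Type*} (G : SimpleGraph V) (f : Equiv.Perm V) : Prop :=
  (∀ x, f (f x) = x) ∧ ∀ x, f x ≠ x → G.Adj x (f x)

/-- A matching involution with as few fixed points as possible, i.e. a maximum matching. -/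
def IsMaxMatchingInvolution {V : Type*} [Fintype V] [DecidableEq V] (G : SimpleGraph V)
    (f : Equiv.Perm V) : Prop :=
  IsMatchingInvolution G f ∧ ∀ g, IsMatchingInvolution G g →
    (Finset.univ.filter fun x => f x = x).card ≤ (Finset.univ.filter fun x => g x = x).card

section Involutions

variable {V : Type*} {f g : Equiv.Perm V}

lemma involution_apply_zpow (hf : ∀ x, f (f x) = x) (hg : ∀ x, g (g x) = x) (z : ℤ) (x : V) :
    f (((g * f) ^ z) x) = ((g * f) ^ (-z)) (f x) := by
  have hf' : f * f = 1 := Equiv.ext hf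
  have hg' : g * g = 1 := Equiv.ext hg
  have hfi : f⁻¹ = f := inv_eq_of_mul_eq_one_left hf'
  have hgi : g⁻¹ = g := inv_eq_of_mul_eq_one_left hg'
  have h1 : f * (g * f) * f⁻¹ = (g * f)⁻¹ := by
    rw [mul_inv_rev, hfi, hgi, mul_assoc, mul_assoc, hf', mul_one]
  have h2 : f * (g * f) ^ z * f⁻¹ = (g * f) ^ (-z) := by
    rw [← conj_zpow, h1, inv_zpow, zpow_neg]
  rw [← h2]
  simp

lemma apply_zpow_of_fixed (hf : ∀ x, f (f x) = x) (hg : ∀ x, g (g x) = x) {t : V}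
    (ht : g t = t) (z : ℤ) : f (((g * f) ^ z) t) = ((g * f) ^ (-z - 1)) t := by
  rw [involution_apply_zpow hf hg, sub_eq_add_neg, zpow_add, Equiv.Perm.mul_apply]
  congr 1
  have : ((g * f) ^ (1 : ℤ)) (f t) = t := by simp [hf, ht]
  rw [zpow_neg, Equiv.Perm.eq_inv_iff_eq, this]

lemma apply_zpow_of_fixed' (hf : ∀ x, f (f x) = x) (hg : ∀ x, g (g x) = x) {t : V}
    (ht : g t = t) (z : ℤ) : g (((g * f) ^ z) t) = ((g * f) ^ (-z)) t := by
  have h := apply_zpow_of_fixed hf hg ht (-z - 1)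
  have h2 : ((g * f) ^ z) t = f (((g * f) ^ (-z - 1)) t) := by rw [h]; congr 2; ring
  rw [h2, ← Equiv.Perm.mul_apply, ← Equiv.Perm.mul_apply, ← zpow_one_add]
  congr 2
  ring

/-- The orbit of a fixed point of `g` under two involutions contains at most one fixed point
of `f`. -/
lemma fixed_unique_in_orbit (hf : ∀ x, f (f x) = x) (hg : ∀ x, g (g x) = x) {t u v : V}
    (ht : g t = t) (hu : f u = u) (hv : f v = v) (htu : (g * f).SameCycle t u)
    (htv : (g * f).SameCycle t v) : u = v := by
  obtain ⟨i, rfl⟩ := htu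
  obtain ⟨j, rfl⟩ := htv
  rw [apply_zpow_of_fixed hf hg ht] at hu hv
  set p := g * f with hp
  let S := MulAction.stabilizer (Equiv.Perm V) t
  have mem {z w : ℤ} (h : (p ^ z) t = (p ^ w) t) : p ^ (w - z) ∈ S := by
    change (p ^ (w - z)) t = t
    rw [show w - z = -z + w by ring, zpow_add, Equiv.Perm.mul_apply, ← h, zpow_neg]
    simp
  have h1 := mem hu
  have h2 := mem hv
  have h3 : p ^ (i - j) ∈ S := by
    have e : p ^ (i - j) = (p ^ (i - (-i - 1))) ^ (i - j) *
        (p ^ (i - (-i - 1)) * (p ^ (j - (-j - 1)))⁻¹) ^ (-i) := by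
      rw [← zpow_neg, ← zpow_add, ← zpow_mul, ← zpow_mul, ← zpow_add]
      congr 1
      ring
    rw [e]
    exact S.mul_mem (S.zpow_mem h1 _) (S.zpow_mem (S.mul_mem h1 (S.inv_mem h2)) _)
  have h4 : (p ^ (i - j)) t = t := h3
  calc (p ^ i) t = (p ^ (j + (i - j))) t := by congr 2; ring
    _ = (p ^ j) t := by rw [zpow_add, Equiv.Perm.mul_apply, h4]

end Involutions

section Gallai

variable {V : Type*} {G : SimpleGraph V}

open Classical in
/-- The matching which agrees with `g` on `C` and with `f` outside `C`. -/
lemma IsMatchingInvolution.exists_swap {f g : Equiv.Perm V} (hf : IsMatchingInvolution G f)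
    (hg : IsMatchingInvolution G g) (C : Set V) (hfC : ∀ x ∈ C, f x ∈ C)
    (hgC : ∀ x ∈ C, g x ∈ C) :
    ∃ h, IsMatchingInvolution G h ∧ ∀ x, h x = if x ∈ C then g x else f x := by
  have hfC' : ∀ x, x ∉ C → f x ∉ C := fun x hx h => hx (hf.1 x ▸ hfC _ h)
  have hinv : Function.Involutive fun x => if x ∈ C then g x else f x := by
    intro x
    by_cases hx : x ∈ C
    · simp [hx, hgC x hx, hg.1]
    · simp [hx, hfC' x hx, hf.1]
  refine ⟨hinv.toPerm _, ⟨hinv, fun x hx => ?_⟩, fun _ => rfl⟩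
  change (if x ∈ C then g x else f x) ≠ x at hx
  change G.Adj x (if x ∈ C then g x else f x)
  split_ifs at hx ⊢
  exacts [hg.2 x hx, hf.2 x hx]

variable [Fintype V] [DecidableEq V]

lemma exists_isMaxMatchingInvolution (G : SimpleGraph V) : ∃ f, IsMaxMatchingInvolution G f := by
  classical
  obtain ⟨f, hf, h⟩ := Finset.exists_min_image
    (Finset.univ.filter fun f : Equiv.Perm V => IsMatchingInvolution G f)
    (fun f => (Finset.univ.filter fun x => f x = x).card)
    ⟨1, Finset.mem_filter.2 ⟨Finset.mem_univ _, fun _ => rfl, fun _ h => absurd rfl h⟩⟩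
  exact ⟨f, by simpa using hf, fun g hg => h g (by simpa using hg)⟩

lemma IsMaxMatchingInvolution.exists_swap {f g : Equiv.Perm V}
    (hf : IsMaxMatchingInvolution G f) (hg : IsMaxMatchingInvolution G g) (C : Set V)
    (hfC : ∀ x ∈ C, f x ∈ C) (hgC : ∀ x ∈ C, g x ∈ C) :
    ∃ h, IsMaxMatchingInvolution G h ∧ (∀ x ∈ C, h x = g x) ∧ ∀ x ∉ C, h x = f x := by
  classical
  obtain ⟨h, hm, hh⟩ := hf.1.exists_swap hg.1 C hfC hgC
  obtain ⟨h', hm', hh'⟩ := hg.1.exists_swap hf.1 C hgC hfC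
  have split (e : Equiv.Perm V) : (Finset.univ.filter fun x => e x = x).card =
      (Finset.univ.filter fun x => e x = x ∧ x ∈ C).card +
      (Finset.univ.filter fun x => e x = x ∧ x ∉ C).card := by
    rw [← Finset.card_filter_add_card_filter_not (s := Finset.univ.filter fun x => e x = x)
      (fun x => x ∈ C), Finset.filter_filter, Finset.filter_filter]
  have hin {e e' : Equiv.Perm V} (he : ∀ x ∈ C, e x = e' x) :
      (Finset.univ.filter fun x => e x = x ∧ x ∈ C).card =
      (Finset.univ.filter fun x => e' x = x ∧ x ∈ C).card := by
    congr 1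
    ext x
    simp only [Finset.mem_filter, Finset.mem_univ, true_and]
    exact and_congr_left fun hx => by rw [he x hx]
  have hout {e e' : Equiv.Perm V} (he : ∀ x ∉ C, e x = e' x) :
      (Finset.univ.filter fun x => e x = x ∧ x ∉ C).card =
      (Finset.univ.filter fun x => e' x = x ∧ x ∉ C).card := by
    congr 1
    ext x
    simp only [Finset.mem_filter, Finset.mem_univ, true_and]
    exact and_congr_left fun hx => by rw [he x hx]
  have i1 : ∀ x ∈ C, h x = g x := fun x hx => by simp [hh, hx]
  have o1 : ∀ x ∉ C, h x = f x := fun x hx => by simp [hh, hx]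
  have i2 : ∀ x ∈ C, h' x = f x := fun x hx => by simp [hh', hx]
  have o2 : ∀ x ∉ C, h' x = g x := fun x hx => by simp [hh', hx]
  refine ⟨h, ⟨hm, fun e he => ?_⟩, i1, o1⟩
  have a := hf.2 e he
  have c := hg.2 h' hm'
  rw [split g, split h', hin i2, hout o2] at c
  rw [split f] at a
  rw [split h, hin i1, hout o1]
  omega

/-- Gallai's lemma: if every vertex is missed by a maximum matching, then the relation
that no maximum matching misses both vertices is transitive. -/
lemma not_both_missed_trans
    (hmiss : ∀ t, ∃ g, IsMaxMatchingInvolution G g ∧ g t = t) {u t v : V}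
    (hut : ∀ f, IsMaxMatchingInvolution G f → f u = u → f t = t → u = t)
    (htv : ∀ f, IsMaxMatchingInvolution G f → f t = t → f v = v → t = v)
    (f : Equiv.Perm V) (hf : IsMaxMatchingInvolution G f) (hu : f u = u) (hv : f v = v) :
    u = v := by
  obtain ⟨g, hg, ht⟩ := hmiss t
  obtain ⟨h, hh, hin, hout⟩ := hf.exists_swap hg {x | (g * f).SameCycle t x}
    (by
      rintro _ ⟨i, rfl⟩
      exact ⟨_, (apply_zpow_of_fixed hf.1.1 hg.1.1 ht i).symm⟩)
    (by
      rintro _ ⟨i, rfl⟩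
      exact ⟨_, (apply_zpow_of_fixed' hf.1.1 hg.1.1 ht i).symm⟩)
  have hht : h t = t := (hin t (Equiv.Perm.SameCycle.refl _ _)).trans ht
  by_cases hcu : (g * f).SameCycle t u
  · by_cases hcv : (g * f).SameCycle t v
    · exact fixed_unique_in_orbit hf.1.1 hg.1.1 ht hu hv hcu hcv
    · have := htv h hh hht ((hout v hcv).trans hv)
      exact absurd (this ▸ Equiv.Perm.SameCycle.refl _ _) hcv
  · have := hut h hh ((hout u hcu).trans hu) hht
    exact absurd (this ▸ Equiv.Perm.SameCycle.refl _ _) hcu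

lemma IsMaxMatchingInvolution.not_adj {f : Equiv.Perm V} (hf : IsMaxMatchingInvolution G f)
    {u v : V} (hu : f u = u) (hv : f v = v) : ¬ G.Adj u v := by
  intro h
  have hne := h.ne
  obtain ⟨e, he, hin, hout⟩ : ∃ e, IsMatchingInvolution G e ∧
      (∀ x, x = u ∨ x = v → e x = Equiv.swap u v x) ∧ ∀ x, ¬ (x = u ∨ x = v) → e x = f x := by
    obtain ⟨e, he, hx⟩ := hf.1.exists_swap (g := Equiv.swap u v)
      ⟨Equiv.swap_apply_self u v, fun x hx => by
        by_cases h1 : x = u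
        · subst h1; simpa using h
        · by_cases h2 : x = v
          · subst h2; simpa using h.symm
          · exact absurd (Equiv.swap_apply_of_ne_of_ne h1 h2) hx⟩ {x | x = u ∨ x = v}
      (by rintro x (rfl | rfl) <;> simp [hu, hv]) (by rintro x (rfl | rfl) <;> simp)
    exact ⟨e, he, fun x h => by rw [hx, if_pos (by exact h)],
      fun x h => by rw [hx, if_neg (by exact h)]⟩
  refine absurd (hf.2 e he) (not_le.2 (Finset.card_lt_card ?_))
  refine Finset.ssubset_iff_of_subset (fun x hx => ?_) |>.2 ⟨u, by simpa using hu, ?_⟩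
  · rw [Finset.mem_filter] at hx ⊢
    refine ⟨hx.1, ?_⟩
    by_cases hxx : x = u ∨ x = v
    · rcases hxx with rfl | rfl <;> assumption
    · rw [← hout x hxx, hx.2]
  · simpa [hin u (Or.inl rfl)] using hne.symm

/-- A connected vertex-transitive graph has a matching missing at most one vertex. -/
theorem exists_nearPerfect_of_vertexTransitive (htrans : ∀ u v, ∃ σ : G ≃g G, σ u = v)
    (hconn : G.Preconnected) :
    ∃ f, IsMatchingInvolution G f ∧ ∀ u v, f u = u → f v = v → u = v := by
  obtain ⟨f, hf⟩ := exists_isMaxMatchingInvolution G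
  refine ⟨f, hf.1, fun u v hu hv => ?_⟩
  have hmiss : ∀ t, ∃ g, IsMaxMatchingInvolution G g ∧ g t = t := by
    intro t
    obtain ⟨σ, rfl⟩ := htrans u t
    let g : Equiv.Perm V := (σ.symm.toEquiv.trans f).trans σ.toEquiv
    have hgx (x : V) : g x = σ (f (σ.symm x)) := rfl
    refine ⟨g, ⟨⟨fun x => by simp [hgx, hf.1.1], fun x hx => ?_⟩, fun e he => ?_⟩, by simp [hgx, hu]⟩
    · have : f (σ.symm x) ≠ σ.symm x := fun h => hx (by simp [hgx, h])
      have h2 := σ.map_adj_iff.2 (hf.1.2 _ this)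
      simpa [hgx] using h2
    · refine le_trans (le_of_eq ?_) (hf.2 e he)
      refine Finset.card_equiv σ.symm.toEquiv fun x => ?_
      simp only [Finset.mem_filter, Finset.mem_univ, true_and, hgx]
      exact σ.toEquiv.eq_symm_apply.symm
  obtain ⟨w⟩ := hconn u v
  have key : ∀ f, IsMaxMatchingInvolution G f → f u = u → f v = v → u = v := by
    clear hu hv
    induction w with
    | nil => intros; rfl
    | cons h _ ih =>
      exact not_both_missed_trans hmiss
        (fun f hf hu hv => absurd h (hf.not_adj hu hv)) ih
  exact key f hf hu hv

end Gallai

section Johnson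

/-- The generalized Johnson graph: `r`-subsets, adjacent when they meet in `k` elements. -/
def generalizedJohnson (n r k : ℕ) : SimpleGraph {A : Finset (Fin n) // A.card = r} where
  Adj A B := A ≠ B ∧ (A.1 ∩ B.1).card = k
  symm := ⟨fun A B h => ⟨h.1.symm, by rw [Finset.inter_comm]; exact h.2⟩⟩
  loopless := ⟨fun A h => h.1 rfl⟩

variable {n r k : ℕ}

lemma generalizedJohnson_transitive (u v : {A : Finset (Fin n) // A.card = r}) :
    ∃ σ : generalizedJohnson n r k ≃g generalizedJohnson n r k, σ u = v := by
  have e : {x // x ∈ u.1} ≃ {x // x ∈ v.1} := Finset.equivOfCardEq (u.2.trans v.2.symm)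
  let τ : Equiv.Perm (Fin n) := e.extendSubtype
  have hτ : u.1.map τ.toEmbedding = v.1 := by
    refine Finset.eq_of_subset_of_card_le (fun x hx => ?_) (by simp [u.2, v.2])
    obtain ⟨y, hy, rfl⟩ := Finset.mem_map.1 hx
    exact e.extendSubtype_mem y hy
  let ρ : {A : Finset (Fin n) // A.card = r} ≃ {A : Finset (Fin n) // A.card = r} :=
    τ.finsetCongr.subtypeEquiv fun A => by simp
  refine ⟨⟨ρ, fun {A B} => ?_⟩, Subtype.ext hτ⟩
  have hρ (A) : (ρ A).1 = A.1.map τ.toEmbedding := rfl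
  simp [generalizedJohnson, hρ, ← Finset.map_inter]

lemma generalizedJohnson_adj (hk : k < r) {A B : {A : Finset (Fin n) // A.card = r}}
    (h : (A.1 ∩ B.1).card = k) : (generalizedJohnson n r k).Adj A B := by
  refine ⟨?_, h⟩
  rintro rfl
  rw [Finset.inter_self, A.2] at h
  omega

/-- Sets differing by one exchange have a common neighbour, unless the graph is the
perfect matching by complementation. -/
lemma generalizedJohnson_reachable_exchange (hk : k < r) (hn : 2 * r - k ≤ n)
    (hne : ¬ (k = 0 ∧ n = 2 * r)) (A A' : {A : Finset (Fin n) // A.card = r}) {a b : Fin n}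
    (ha : a ∈ A.1) (hb : b ∉ A.1) (hA' : A'.1 = insert b (A.1.erase a)) :
    (generalizedJohnson n r k).Reachable A A' := by
  have hab : a ≠ b := fun h => hb (h ▸ ha)
  have hAr := A.2
  have c1 : (A.1.erase a).card = r - 1 := by rw [Finset.card_erase_of_mem ha, hAr]
  have c2 : (insert b A.1)ᶜ.card = n - (r + 1) := by
    rw [Finset.card_compl, Fintype.card_fin, Finset.card_insert_of_notMem hb, hAr]
  suffices ∃ B : Finset (Fin n), B.card = r ∧ (A.1 ∩ B).card = k ∧ (A'.1 ∩ B).card = k by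
    obtain ⟨B, hB, h1, h2⟩ := this
    have e1 : (generalizedJohnson n r k).Adj A ⟨B, hB⟩ := generalizedJohnson_adj hk h1
    have e2 : (generalizedJohnson n r k).Adj A' ⟨B, hB⟩ := generalizedJohnson_adj hk h2
    exact e1.reachable.trans e2.symm.reachable
  rw [hA']
  by_cases h0 : k = 0
  · obtain ⟨T, hT, hTc⟩ := Finset.exists_subset_card_eq (s := (insert b A.1)ᶜ) (n := r)
      (by omega)
    refine ⟨T, hTc, ?_, ?_⟩ <;> rw [h0, Finset.card_eq_zero, Finset.eq_empty_iff_forall_notMem]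
      <;> intro x hx <;> have := @hT x <;> simp at hx this <;> grind
  · obtain ⟨S, hS, hSc⟩ := Finset.exists_subset_card_eq (s := A.1.erase a) (n := k - 1)
      (by omega)
    obtain ⟨T, hT, hTc⟩ := Finset.exists_subset_card_eq (s := (insert b A.1)ᶜ) (n := r - k - 1)
      (by omega)
    have hS' (x) (hx : x ∈ S) : x ≠ a ∧ x ∈ A.1 := by simpa using hS hx
    have hT' (x) (hx : x ∈ T) : x ≠ b ∧ x ∉ A.1 := by simpa using hT hx
    have hST : Disjoint S T :=
      Finset.disjoint_left.2 fun x h1 h2 => (hT' x h2).2 (hS' x h1).2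
    have haS : a ∉ S := fun h => (hS' a h).1 rfl
    have hbS : b ∉ S := fun h => hb (hS' b h).2
    have haT : a ∉ T := fun h => (hT' a h).2 ha
    have hbT : b ∉ T := fun h => (hT' b h).1 rfl
    refine ⟨insert a (insert b (S ∪ T)), ?_, ?_, ?_⟩
    · rw [Finset.card_insert_of_notMem (by simp [*]), Finset.card_insert_of_notMem (by simp [*]),
        Finset.card_union_of_disjoint hST, hSc, hTc]
      omega
    · have : A.1 ∩ insert a (insert b (S ∪ T)) = insert a S := by
        ext x
        simp only [Finset.mem_inter, Finset.mem_insert, Finset.mem_union]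
        grind
      rw [this, Finset.card_insert_of_notMem haS]
      omega
    · have : insert b (A.1.erase a) ∩ insert a (insert b (S ∪ T)) = insert b S := by
        ext x
        simp only [Finset.mem_inter, Finset.mem_insert, Finset.mem_union, Finset.mem_erase]
        grind
      rw [this, Finset.card_insert_of_notMem hbS]
      omega

lemma generalizedJohnson_preconnected (hk : k < r) (hn : 2 * r - k ≤ n)
    (hne : ¬ (k = 0 ∧ n = 2 * r)) : (generalizedJohnson n r k).Preconnected := by
  intro A B
  induction hm : (A.1 \ B.1).card generalizing A with
  | zero =>
    have hsub : A.1 ⊆ B.1 := by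
      rwa [Finset.card_eq_zero, Finset.sdiff_eq_empty_iff_subset] at hm
    have : A = B := Subtype.ext (Finset.eq_of_subset_of_card_le hsub (by rw [A.2, B.2]))
    rw [this]
  | succ m ih =>
    have hBA : (B.1 \ A.1).card = m + 1 := by
      rw [← hm]
      exact Finset.card_sdiff_comm (B.2.trans A.2.symm)
    obtain ⟨a, ha⟩ := Finset.card_pos.1 (by omega : 0 < (A.1 \ B.1).card)
    obtain ⟨b, hb⟩ := Finset.card_pos.1 (by omega : 0 < (B.1 \ A.1).card)
    rw [Finset.mem_sdiff] at ha hb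
    have hc : (insert b (A.1.erase a)).card = r := by
      have := A.2
      have := Finset.card_pos.2 ⟨a, ha.1⟩
      rw [Finset.card_insert_of_notMem (by simp [hb.2]), Finset.card_erase_of_mem ha.1]
      omega
    refine (generalizedJohnson_reachable_exchange hk hn hne A ⟨_, hc⟩ ha.1 hb.2 rfl).trans
      (ih ⟨_, hc⟩ ?_)
    have : insert b (A.1.erase a) \ B.1 = (A.1 \ B.1).erase a := by
      ext x
      simp only [Finset.mem_sdiff, Finset.mem_insert, Finset.mem_erase]
      grind
    change (insert b (A.1.erase a) \ B.1).card = m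
    rw [this, Finset.card_erase_of_mem (Finset.mem_sdiff.2 ha)]
    omega

lemma generalizedJohnson_exists_nearPerfect (hk : k < r) (hn : 2 * r - k ≤ n) :
    ∃ f, IsMatchingInvolution (generalizedJohnson n r k) f ∧
      ∀ u v, f u = u → f v = v → u = v := by
  by_cases hne : k = 0 ∧ n = 2 * r
  · obtain ⟨rfl, rfl⟩ := hne
    let c : {A : Finset (Fin (2 * r)) // A.card = r} → {A : Finset (Fin (2 * r)) // A.card = r} :=
      fun A => ⟨A.1ᶜ, by rw [Finset.card_compl, Fintype.card_fin, A.2]; omega⟩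
    have hc : Function.Involutive c := fun A => Subtype.ext (compl_compl A.1)
    have hadj (A) : (generalizedJohnson (2 * r) r 0).Adj A (c A) :=
      generalizedJohnson_adj hk (by simp [c])
    exact ⟨hc.toPerm c, ⟨hc, fun A _ => hadj A⟩, fun u _ hu _ => absurd hu.symm (hadj u).ne⟩
  · exact exists_nearPerfect_of_vertexTransitive generalizedJohnson_transitive
      (generalizedJohnson_preconnected hk hn hne)

end Johnson

/-- The number of parts of the matching given by an involution with at most one fixed point. -/
lemma two_mul_card_image_pair_le {V : Type*} [Fintype V] [DecidableEq V] {f : V → V}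
    (hf : Function.Involutive f) (hfix : ∀ u v, f u = u → f v = v → u = v) :
    2 * (Finset.univ.image fun x => ({x, f x} : Finset V)).card ≤ Fintype.card V + 1 := by
  set p : V → Finset V := fun x => {x, f x}
  set A := Finset.univ.filter fun x => f x = x
  set B := Finset.univ.filter fun x => ¬ f x = x
  have hAB : A.card + B.card = Fintype.card V :=
    Finset.card_filter_add_card_filter_not (s := Finset.univ) _
  have hA : A.card ≤ 1 := Finset.card_le_one.2 fun u hu v hv =>
    hfix u v (Finset.mem_filter.1 hu).2 (Finset.mem_filter.1 hv).2
  have hU : Finset.univ.image p = A.image p ∪ B.image p := by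
    rw [← Finset.image_union, Finset.filter_union_filter_not_eq]
  have hB : 2 * (B.image p).card ≤ B.card := by
    refine Finset.mul_card_image_le_card B 2 fun q hq => ?_
    obtain ⟨x, hx, rfl⟩ := Finset.mem_image.1 hq
    have hx' : f x ≠ x := (Finset.mem_filter.1 hx).2
    rw [← Finset.card_pair hx'.symm]
    refine Finset.card_le_card fun y hy => ?_
    rw [Finset.mem_filter]
    rcases Finset.mem_insert.1 hy with rfl | hy
    · exact ⟨hx, rfl⟩
    · rw [Finset.mem_singleton] at hy
      subst hy
      refine ⟨Finset.mem_filter.2 ⟨Finset.mem_univ _, fun h => hx' (hf.injective h)⟩, ?_⟩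
      simp only [p, hf x]
      exact Finset.pair_comm _ _
  have h1 := Finset.card_union_le (A.image p) (B.image p)
  have h2 : (A.image p).card ≤ A.card := Finset.card_image_le
  rw [hU]
  omega

lemma phiPair_le {r k n : ℕ} (hk : k < r) (hn : 2 * r - k ≤ n) (G : Finset (Finset (Fin n)))
    (hG : ∀ e ∈ G, e.card = r) : phiPair k G ≤ (n.choose r + 1) / 2 := by
  classical
  obtain ⟨f, hf, hfix⟩ := generalizedJohnson_exists_nearPerfect hk hn
  have hcard := two_mul_card_image_pair_le (f := f) hf.1 hfix
  have hV : Fintype.card {A : Finset (Fin n) // A.card = r} = n.choose r := by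
    rw [Fintype.card_finset_len, Fintype.card_fin]
  rw [hV] at hcard
  set Q := Finset.univ.image fun x => ({x, f x} : Finset {A : Finset (Fin n) // A.card = r})
  let restr : Finset {A : Finset (Fin n) // A.card = r} → Finset (Finset (Fin n)) :=
    fun q => q.map (Function.Embedding.subtype _) ∩ G
  set P := (Q.image restr).erase ∅
  have hPc : P.card ≤ Q.card := (Finset.card_erase_le).trans Finset.card_image_le
  have hP : ∀ p ∈ P, p ≠ ∅ ∧ ∃ x, p = restr {x, f x} := by
    intro p hp
    simp only [P, Q, Finset.mem_erase, Finset.mem_image, Finset.mem_univ, true_and] at hp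
    obtain ⟨h0, _, ⟨x, rfl⟩, rfl⟩ := hp
    exact ⟨h0, x, rfl⟩
  have hmem (x) (e) : e ∈ restr {x, f x} ↔ (e = x.1 ∨ e = (f x).1) ∧ e ∈ G := by
    simp only [restr, Finset.mem_inter, Finset.map_insert, Finset.map_singleton,
      Finset.mem_insert, Finset.mem_singleton, Function.Embedding.subtype_apply]
  have hpair (x) : ({x, f x} : Finset {A : Finset (Fin n) // A.card = r}) = {f x, f (f x)} := by
    rw [hf.1, Finset.pair_comm]
  refine le_trans (Nat.sInf_le ⟨P, ⟨?_, ?_, ?_⟩, rfl⟩) (by omega)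
  · intro p hp q hq hpq
    obtain ⟨-, x, rfl⟩ := hP p hp
    obtain ⟨-, y, rfl⟩ := hP q hq
    refine Finset.disjoint_left.2 fun e he he' => hpq ?_
    rw [hmem] at he he'
    have aux {z : {A : Finset (Fin n) // A.card = r}} (h : e = z.1 ∨ e = (f z).1) :
        restr {z, f z} = restr {⟨e, hG e he.2⟩, f ⟨e, hG e he.2⟩} := by
      rcases h with h | h
      · rw [show (⟨e, hG e he.2⟩ : {A : Finset (Fin n) // A.card = r}) = z from Subtype.ext h]
      · rw [show (⟨e, hG e he.2⟩ : {A : Finset (Fin n) // A.card = r}) = f z from Subtype.ext h,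
          hpair]
    rw [aux he.1, aux he'.1]
  · ext e
    simp only [Finset.mem_biUnion, id]
    constructor
    · rintro ⟨p, hp, he⟩
      obtain ⟨-, x, rfl⟩ := hP p hp
      exact ((hmem _ _).1 he).2
    · intro he
      have h := (hmem ⟨e, hG e he⟩ e).2 ⟨Or.inl rfl, he⟩
      exact ⟨_, Finset.mem_erase.2 ⟨Finset.ne_empty_of_mem h, Finset.mem_image_of_mem _
        (Finset.mem_image_of_mem _ (Finset.mem_univ _))⟩, h⟩
  · intro p hp
    obtain ⟨h0, x, rfl⟩ := hP p hp
    obtain ⟨e, he⟩ := Finset.nonempty_iff_ne_empty.2 h0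
    by_cases hs : x.1 ∈ G ∧ (f x).1 ∈ G ∧ f x ≠ x
    · right
      refine ⟨x.1, (f x).1, fun h => hs.2.2 (Subtype.ext h.symm), (hf.2 x hs.2.2).2, ?_⟩
      ext y
      rw [hmem, Finset.mem_insert, Finset.mem_singleton]
      grind
    · left
      refine ⟨e, ?_⟩
      ext y
      rw [hmem] at he ⊢
      rw [Finset.mem_singleton]
      have : f x = x ↔ (f x).1 = x.1 := Subtype.ext_iff
      grind

lemma card_le_two_mul_phiPair {k n : ℕ} (G : Finset (Finset (Fin n))) :
    G.card ≤ 2 * phiPair k G := by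
  have hne : {m | ∃ P, IsPairDecomp k G P ∧ P.card = m}.Nonempty := by
    refine ⟨_, G.image fun e => {e}, ⟨?_, ?_, ?_⟩, rfl⟩
    · simp only [Finset.mem_image]
      rintro _ ⟨e, -, rfl⟩ _ ⟨f, -, rfl⟩ h
      rw [Finset.disjoint_singleton]
      rintro rfl
      exact h rfl
    · ext
      simp
    · intro p hp
      obtain ⟨e, -, rfl⟩ := Finset.mem_image.1 hp
      exact Or.inl ⟨e, rfl⟩
  obtain ⟨P, ⟨-, hU, hP⟩, hc⟩ := Nat.sInf_mem hne
  change P.card = phiPair k G at hc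
  rw [← hc, ← hU, mul_comm]
  refine Finset.card_biUnion_le_card_mul _ _ _ fun p hp => ?_
  rcases hP p hp with ⟨e, rfl⟩ | ⟨e, f, -, -, rfl⟩
  · simp
  · exact Finset.card_le_two

/-- If `0 ≤ k ≤ r - 1` and `n ≥ 2r - k`, and `H` is the `r`-graph with exactly two edges
intersecting in exactly `k` vertices, then `φ_H^r(n) = ⌈C(n,r)/2⌉`. -/
theorem phiPairMax_eq (r k n : ℕ) (hk : k + 1 ≤ r) (hn : 2 * r - k ≤ n) :
    phiPairMax r k n = (n.choose r + 1) / 2 := by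
  refine IsGreatest.csSup_eq ⟨⟨Finset.powersetCard r Finset.univ,
    fun e he => (Finset.mem_powersetCard.1 he).2, ?_⟩, ?_⟩
  · refine le_antisymm (phiPair_le hk hn _ fun e he => (Finset.mem_powersetCard.1 he).2) ?_
    have := card_le_two_mul_phiPair (k := k) (Finset.powersetCard r (Finset.univ : Finset (Fin n)))
    rw [Finset.card_powersetCard, Finset.card_fin] at this
    omega
  · rintro _ ⟨G, hG, rfl⟩
    exact phiPair_le hk hn G hG
end

section
/- Let r and k be integers with 0 ≤ k ≤ r−1 and n ≥ 2r−k, and let H be the r-uniform hypergraph consisting of exactly two edges whose intersection has exactly k vertices. Then φ_H^r(K_n^r) = ⌈(1/2)·C(n,r)⌉, where K_n^r is the complete r-graph on n vertices. -/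
namespace SimpleGraph

variable {V : Type*} [Fintype V] [DecidableEq V]

/-- A matching of `G`, encoded as the involution that swaps the ends of each matching edge and
fixes every uncovered vertex. -/
structure IsMatchingInvol (G : SimpleGraph V) (M : V → V) : Prop where
  invol : ∀ v, M (M v) = v
  adj : ∀ v, M v ≠ v → G.Adj v (M v)

/-- The set of vertices left uncovered by a matching involution. -/
def uncovered (M : V → V) : Finset V := Finset.univ.filter fun v => M v = v

/-- A matching involution with the least possible number of uncovered vertices. -/
structure IsMaxMatchingInvol (G : SimpleGraph V) (M : V → V) : Prop
    extends G.IsMatchingInvol M where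
  card_le : ∀ N, G.IsMatchingInvol N → (uncovered M).card ≤ (uncovered N).card

@[simp]
lemma mem_uncovered {M : V → V} {v : V} : v ∈ uncovered M ↔ M v = v := by simp [uncovered]

lemma exists_isMaxMatchingInvol (G : SimpleGraph V) : ∃ M, G.IsMaxMatchingInvol M := by
  classical
  obtain ⟨M, hM, hmin⟩ := Finset.exists_min_image
    (Finset.univ.filter fun M : V → V => G.IsMatchingInvol M) (fun M => (uncovered M).card)
    ⟨id, by simpa using ⟨fun _ => rfl, fun v h => (h rfl).elim⟩⟩
  simp only [Finset.mem_filter, Finset.mem_univ, true_and] at hM hmin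
  exact ⟨M, hM, hmin⟩

lemma IsMaxMatchingInvol.not_adj {G : SimpleGraph V} {M : V → V} (hM : G.IsMaxMatchingInvol M)
    {u v : V} (hu : M u = u) (hv : M v = v) : ¬ G.Adj u v := by
  intro h
  have hne := h.ne
  have hs := h.symm
  have hinv := hM.invol
  have hadj := hM.adj
  let N : V → V := fun w => if w = u then v else if w = v then u else M w
  have hN : G.IsMatchingInvol N := by
    constructor
    · intro w; grind
    · intro w hw; grind
  have hlt : uncovered N ⊂ uncovered M := by
    rw [Finset.ssubset_iff_of_subset (fun w hw => by simp only [mem_uncovered] at *; grind)]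
    exact ⟨u, by simpa using hu, by simp only [mem_uncovered]; grind⟩
  exact absurd (Finset.card_lt_card hlt) (not_lt.2 (hM.card_le N hN))

/-- A graph automorphism carries maximum matchings to maximum matchings. -/
lemma IsMaxMatchingInvol.conj {G : SimpleGraph V} {M : V → V} (hM : G.IsMaxMatchingInvol M)
    (e : G ≃g G) : G.IsMaxMatchingInvol fun v => e (M (e.symm v)) := by
  refine ⟨⟨fun v => by simp [hM.invol], fun v hv => ?_⟩, fun N hN => ?_⟩
  · have := hM.adj (e.symm v) (fun h => hv (by simp [h]))
    simpa using e.map_rel_iff.2 this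
  · refine le_trans (le_of_eq ?_) (hM.card_le N hN)
    refine Finset.card_bij (fun v _ => e.symm v) (fun v hv => ?_) (fun _ _ _ _ h => by simpa using h)
      (fun w hw => ⟨e w, ?_, by simp⟩)
    · simp only [mem_uncovered] at *
      rw [eq_comm, e.symm_apply_eq, hv]
    · simp only [mem_uncovered] at *
      simp [hw]

/-- Two vertices are matching-parallel if no maximum matching leaves both of them uncovered,
or if they are equal. -/
def MatchingParallel (G : SimpleGraph V) (u v : V) : Prop :=
  ∀ M, G.IsMaxMatchingInvol M → M u = u → M v = v → u = v

lemma Adj.matchingParallel {G : SimpleGraph V} {u v : V} (h : G.Adj u v) :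
    G.MatchingParallel u v :=
  fun _ hM hu hv => (hM.not_adj hu hv h).elim

/-- The exchange argument behind Gallai's lemma. -/
lemma MatchingParallel.trans {G : SimpleGraph V} {u t v : V} (hut : G.MatchingParallel u t)
    (htv : G.MatchingParallel t v) (ht : ∃ N, G.IsMaxMatchingInvol N ∧ N t = t) :
    G.MatchingParallel u v := by
  classical
  intro M hM hu hv
  by_contra huv
  obtain ⟨N, hN, hmax⟩ := Finset.exists_max_image
    (Finset.univ.filter fun N : V → V => G.IsMaxMatchingInvol N ∧ N t = t)
    (fun N => (Finset.univ.filter fun w => M w = N w).card)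
    (by obtain ⟨N, hN⟩ := ht; exact ⟨N, by simpa using hN⟩)
  simp only [Finset.mem_filter, Finset.mem_univ, true_and] at hN hmax
  obtain ⟨hN, hNt⟩ := hN
  have hMt : M t ≠ t := fun h => by
    have h1 := hut M hM hu h
    have h2 := htv M hM h hv
    exact huv (h1.trans h2)
  have hut' : u ≠ t := fun h => hMt (h ▸ hu)
  have htv' : t ≠ v := fun h => hMt (h ▸ hv)
  have hNu : N u ≠ u := fun h => hut' (hut N hN h hNt)
  have hNv : N v ≠ v := fun h => htv' (htv N hN hNt h)
  have hcard : (uncovered M).card = (uncovered N).card :=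
    le_antisymm (hM.card_le N hN.1) (hN.card_le M hM.1)
  obtain ⟨x, hxt, hNx, hMx⟩ : ∃ x, x ≠ t ∧ N x = x ∧ M x ≠ x := by
    by_contra! hcon
    have h1 : (uncovered N).erase t ⊆ ((uncovered M).erase u).erase v := by
      intro x hx
      simp only [Finset.mem_erase, mem_uncovered] at *
      exact ⟨fun h => hNv (h ▸ hx.2), fun h => hNu (h ▸ hx.2), hcon x hx.1 hx.2⟩
    have h2 := Finset.card_le_card h1
    rw [Finset.card_erase_of_mem (by simpa using hNt),
      Finset.card_erase_of_mem (by simpa [hv] using Ne.symm huv),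
      Finset.card_erase_of_mem (by simpa using hu)] at h2
    have h3 : 1 < (uncovered M).card :=
      Finset.one_lt_card.2 ⟨u, by simpa using hu, v, by simpa using hv, huv⟩
    omega
  obtain ⟨y, hy⟩ : ∃ y, y = M x := ⟨_, rfl⟩
  have hxy : G.Adj x y := hy ▸ hM.adj x hMx
  have hyx := hxy.symm
  have hMy : M y = x := by rw [hy, hM.invol]
  have hNy : N y ≠ y := fun h => hN.not_adj hNx h hxy
  obtain ⟨z, hz⟩ : ∃ z, z = N y := ⟨_, rfl⟩
  have hNz : N z = y := by rw [hz, hN.invol]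
  have hne := hxy.ne
  have hzx : z ≠ x := by grind
  have hMinv := hM.invol
  have hNinv := hN.invol
  have hNadj := hN.adj
  let N' : V → V := fun w => if w = x then y else if w = y then x else if w = z then z else N w
  have hN' : G.IsMatchingInvol N' := by
    constructor
    · intro w; grind
    · intro w hw; grind
  have huncov : uncovered N' ⊆ insert z ((uncovered N).erase x) := by
    intro w hw
    simp only [mem_uncovered, Finset.mem_insert, Finset.mem_erase] at *
    grind
  have hle : (uncovered N').card ≤ (uncovered N).card := by
    refine (Finset.card_le_card huncov).trans ((Finset.card_insert_le _ _).trans ?_)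
    rw [Finset.card_erase_add_one (by simpa using hNx)]
  have hmaxN' : G.IsMaxMatchingInvol N' := ⟨hN', fun L hL => hle.trans (hN.card_le L hL)⟩
  have hN't : N' t = t := by grind
  refine absurd (hmax N' ⟨hmaxN', hN't⟩) (not_le.2 (Finset.card_lt_card ?_))
  rw [Finset.ssubset_iff_of_subset (fun w hw => by
    simp only [Finset.mem_filter, Finset.mem_univ, true_and] at *; grind)]
  exact ⟨x, by simp [N', hy], by simpa [hNx] using hMx⟩

end SimpleGraph

namespace Finset

variable {α : Type*} [DecidableEq α]

/-- Any two sets of the same size are joined by single-element exchanges. -/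
lemma exchange_induction {p : Finset α → Prop} {s : Finset α} (hs : p s)
    (step : ∀ t a b, t.card = s.card → a ∈ t → b ∉ t → p t → p (insert b (t.erase a)))
    (t : Finset α) (ht : t.card = s.card) : p t := by
  induction h : (t \ s).card using Nat.strong_induction_on generalizing t with
  | _ m ih =>
    by_cases hsub : t ⊆ s
    · rwa [eq_of_subset_of_card_le hsub ht.ge]
    · obtain ⟨b, hbt, hbs⟩ := not_subset.1 hsub
      obtain ⟨a, has, hat⟩ := not_subset.1
        (fun hst : s ⊆ t => hsub (eq_of_subset_of_card_le hst ht.le).ge)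
      have hab : a ≠ b := fun h => hat (h ▸ hbt)
      have hcard : (insert a (t.erase b)).card = s.card := by
        rw [card_insert_of_notMem (by simp [hat]), card_erase_add_one hbt, ht]
      have hlt : (insert a (t.erase b) \ s).card < m := by
        rw [← h]
        refine card_lt_card ?_
        rw [ssubset_iff_of_subset (fun w hw => by grind)]
        exact ⟨b, by grind, by grind⟩
      have := step _ a b hcard (mem_insert_self _ _) (by simp [hab.symm]) (ih _ hlt _ hcard rfl)
      rwa [erase_insert (by simp [hat]), insert_erase hbt] at this

end Finset

/-- The generalized Johnson graph: two distinct `r`-sets are adjacent when they share exactly `k`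
elements. Sets of other sizes are isolated vertices. -/
def johnsonGraph (n r k : ℕ) : SimpleGraph (Finset (Fin n)) where
  Adj s t := s.card = r ∧ t.card = r ∧ s ≠ t ∧ (s ∩ t).card = k
  symm := ⟨fun s t ⟨h1, h2, h3, h4⟩ => ⟨h2, h1, h3.symm, by rwa [Finset.inter_comm]⟩⟩
  loopless := ⟨fun _ h => h.2.2.1 rfl⟩

namespace johnsonGraph

variable {n r k : ℕ}

/-- The automorphism of `johnsonGraph n r k` induced by a permutation of the ground set. -/
def permIso (n r k : ℕ) (σ : Equiv.Perm (Fin n)) : johnsonGraph n r k ≃g johnsonGraph n r k where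
  toEquiv := σ.finsetCongr
  map_rel_iff' := by
    intro s t
    simp only [johnsonGraph, Equiv.finsetCongr_apply, Finset.card_map, ne_eq, Finset.map_inj,
      ← Finset.map_inter]

lemma permIso_swap {s : Finset (Fin n)} {a b : Fin n} (ha : a ∈ s) (hb : b ∉ s) :
    permIso n r k (Equiv.swap a b) s = insert b (s.erase a) := by
  ext x
  change x ∈ s.map (Equiv.swap a b).toEmbedding ↔ _
  simp only [Finset.mem_map_equiv, Equiv.symm_swap, Finset.mem_insert, Finset.mem_erase]
  rcases eq_or_ne x a with rfl | hxa
  · rw [Equiv.swap_apply_left]; grind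
  · rcases eq_or_ne x b with rfl | hxb
    · rw [Equiv.swap_apply_right]; grind
    · rw [Equiv.swap_apply_of_ne_of_ne hxa hxb]; grind

/-- Two `r`-sets differing by one exchange have a common neighbour. -/
lemma exists_common_neighbor (hk : k + 1 ≤ r) (hn : 2 * r - k ≤ n) (h : k ≠ 0 ∨ n ≠ 2 * r)
    {s : Finset (Fin n)} {a b : Fin n} (hs : s.card = r) (ha : a ∈ s) (hb : b ∉ s) :
    ∃ c, (johnsonGraph n r k).Adj s c ∧ (johnsonGraph n r k).Adj c (insert b (s.erase a)) := by
  have hcore : (s.erase a).card = r - 1 := by rw [Finset.card_erase_of_mem ha, hs]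
  have hout : (insert b s)ᶜ.card = n - (r + 1) := by
    rw [Finset.card_compl, Finset.card_insert_of_notMem hb, hs, Fintype.card_fin]
  have key : ∀ c : Finset (Fin n), c.card = r → (s ∩ c).card = k →
      (c ∩ insert b (s.erase a)).card = k →
      (johnsonGraph n r k).Adj s c ∧ (johnsonGraph n r k).Adj c (insert b (s.erase a)) := by
    intro c h1 h2 h3
    have h4 : (insert b (s.erase a)).card = r := by
      rw [Finset.card_insert_of_notMem (by simp [hb]), hcore]; omega
    refine ⟨⟨hs, h1, ?_, h2⟩, ⟨h1, h4, ?_, h3⟩⟩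
    · rintro rfl; rw [Finset.inter_self] at h2; omega
    · rintro rfl; rw [Finset.inter_self] at h3; omega
  by_cases hlt : 2 * r - k < n
  · obtain ⟨x, hx, hxc⟩ := Finset.exists_subset_card_eq (s := s.erase a) (n := k) (by omega)
    obtain ⟨y, hy, hyc⟩ := Finset.exists_subset_card_eq (s := (insert b s)ᶜ) (n := r - k) (by omega)
    have hx' : ∀ w ∈ x, w ≠ a ∧ w ∈ s := fun w hw => by simpa using hx hw
    have hy' : ∀ w ∈ y, w ≠ b ∧ w ∉ s := fun w hw => by simpa using hy hw
    refine ⟨x ∪ y, key _ ?_ ?_ ?_⟩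
    · rw [Finset.card_union_of_disjoint (Finset.disjoint_left.2 fun w h1 h2 => (hy' w h2).2
        (hx' w h1).2)]
      omega
    · rw [← hxc]; congr 1; ext w; grind
    · rw [← hxc]; congr 1; ext w; grind
  · have hk0 : k ≠ 0 := by omega
    obtain ⟨x, hx, hxc⟩ := Finset.exists_subset_card_eq (s := s.erase a) (n := k - 1) (by omega)
    obtain ⟨y, hy, hyc⟩ := Finset.exists_subset_card_eq (s := (insert b s)ᶜ) (n := r - k - 1)
      (by omega)
    have hx' : ∀ w ∈ x, w ≠ a ∧ w ∈ s := fun w hw => by simpa using hx hw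
    have hy' : ∀ w ∈ y, w ≠ b ∧ w ∉ s := fun w hw => by simpa using hy hw
    have hax : a ∉ x := fun h => (hx' a h).1 rfl
    have hbx : b ∉ x := fun h => hb (hx' b h).2
    have hby : b ∉ y := fun h => (hy' b h).1 rfl
    have hay : a ∉ y := fun h => (hy' a h).2 ha
    have hab : a ≠ b := fun h => hb (h ▸ ha)
    refine ⟨insert a (insert b (x ∪ y)), key _ ?_ ?_ ?_⟩
    · rw [Finset.card_insert_of_notMem (by simp [hab, hax, hay]),
        Finset.card_insert_of_notMem (by simp [hbx, hby]),
        Finset.card_union_of_disjoint (Finset.disjoint_left.2 fun w h1 h2 => (hy' w h2).2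
        (hx' w h1).2)]
      omega
    · trans (insert a x).card
      · congr 1; ext w; grind
      · rw [Finset.card_insert_of_notMem hax]; omega
    · trans (insert b x).card
      · congr 1; ext w; grind
      · rw [Finset.card_insert_of_notMem hbx]; omega

/-- The generalized Johnson graph has a matching covering all `r`-sets but at most one. -/
theorem exists_nearPerfect_matching (hk : k + 1 ≤ r) (hn : 2 * r - k ≤ n) :
    ∃ M, (johnsonGraph n r k).IsMatchingInvol M ∧
      ∀ s t : Finset (Fin n), s.card = r → t.card = r → M s = s → M t = t → s = t := by
  by_cases h : k ≠ 0 ∨ n ≠ 2 * r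
  · obtain ⟨M, hM⟩ := (johnsonGraph n r k).exists_isMaxMatchingInvol
    refine ⟨M, hM.1, fun s t hs ht hMs hMt => ?_⟩
    have miss : ∀ u : Finset (Fin n), u.card = s.card →
        ∃ N, (johnsonGraph n r k).IsMaxMatchingInvol N ∧ N u = u := by
      refine Finset.exchange_induction ⟨M, hM, hMs⟩ ?_
      rintro u a b - ha hb ⟨N, hN, hNu⟩
      refine ⟨_, hN.conj (permIso n r k (Equiv.swap a b)), ?_⟩
      rw [← permIso_swap (r := r) (k := k) ha hb]
      simp [hNu]
    refine Finset.exchange_induction (p := (johnsonGraph n r k).MatchingParallel s)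
      (fun _ _ _ _ => rfl) ?_ t (ht.trans hs.symm) M hM hMs hMt
    intro u a b hu ha hb hsu
    obtain ⟨c, h1, h2⟩ := exists_common_neighbor hk hn h (hu.trans hs) ha hb
    exact hsu.trans (h1.matchingParallel.trans h2.matchingParallel (miss c (h1.2.1.trans hs.symm)))
      (miss u hu)
  · obtain ⟨rfl, rfl⟩ : k = 0 ∧ n = 2 * r := by omega
    have hcompl : ∀ s : Finset (Fin (2 * r)), s.card = r → sᶜ.card = r := fun s hs => by
      rw [Finset.card_compl, hs, Fintype.card_fin]; omega
    have hne : ∀ s : Finset (Fin (2 * r)), s.card = r → s ≠ sᶜ := fun s hs h => by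
      have := Finset.inter_compl s
      rw [← h, Finset.inter_self] at this
      rw [this, Finset.card_empty] at hs
      omega
    refine ⟨fun s => if s.card = r then sᶜ else s, ⟨fun s => ?_, fun s hs => ?_⟩,
      fun s t hs _ hMs _ => ?_⟩
    · by_cases hs : s.card = r
      · simp [hs, hcompl s hs]
      · simp [hs]
    · by_cases hsr : s.card = r
      · simp only [hsr, if_true]
        exact ⟨hsr, hcompl s hsr, hne s hsr, by simp⟩
      · simp [hsr] at hs
    · simp only [hs, if_true] at hMs
      exact (hne s hs hMs.symm).elim

end johnsonGraph

namespace IsPairDecomp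

variable {n k : ℕ} {G : Finset (Finset (Fin n))} {P : Finset (Finset (Finset (Fin n)))}

lemma sum_card (hP : IsPairDecomp k G P) : ∑ p ∈ P, p.card = G.card := by
  rw [← hP.2.1]
  exact (Finset.card_biUnion fun p hp q hq => hP.1 p hp q hq).symm

lemma card_le_two (hP : IsPairDecomp k G P) {p : Finset (Finset (Fin n))} (hp : p ∈ P) :
    p.card ≤ 2 := by
  rcases hP.2.2 p hp with ⟨e, rfl⟩ | ⟨e, f, -, -, rfl⟩
  · simp
  · exact Finset.card_le_two

lemma card_le_two_mul (hP : IsPairDecomp k G P) : G.card ≤ 2 * P.card := by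
  rw [← hP.sum_card, mul_comm]
  exact Finset.sum_le_card_nsmul P _ 2 fun p hp => hP.card_le_two hp

/-- A pair decomposition with at most one singleton part has at most `⌈|G| / 2⌉` parts. -/
lemma two_mul_card_le (hP : IsPairDecomp k G P)
    (h : ∀ e f, {e} ∈ P → {f} ∈ P → e = f) : 2 * P.card ≤ G.card + 1 := by
  have h1 : (P.filter fun p => p.card = 1).card ≤ 1 := by
    rw [Finset.card_le_one]
    intro p hp q hq
    simp only [Finset.mem_filter, Finset.card_eq_one] at hp hq
    obtain ⟨hp, e, rfl⟩ := hp
    obtain ⟨hq, f, rfl⟩ := hq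
    rw [h e f hp hq]
  have h2 : ∑ p ∈ P, 2 ≤ ∑ p ∈ P, (p.card + if p.card = 1 then 1 else 0) := by
    refine Finset.sum_le_sum fun p hp => ?_
    rcases hP.2.2 p hp with ⟨e, rfl⟩ | ⟨e, f, hef, -, rfl⟩
    · simp
    · simp [Finset.card_pair hef]
  rw [Finset.sum_add_distrib, hP.sum_card, ← Finset.card_filter, Finset.sum_const,
    smul_eq_mul] at h2
  omega

end IsPairDecomp

lemma johnsonGraph.isPairDecomp {n r k : ℕ} {M : Finset (Fin n) → Finset (Fin n)}
    (hM : (johnsonGraph n r k).IsMatchingInvol M) :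
    IsPairDecomp k (Finset.powersetCard r (Finset.univ : Finset (Fin n)))
      ((Finset.powersetCard r (Finset.univ : Finset (Fin n))).image fun s => {s, M s}) := by
  have hinv := hM.invol
  refine ⟨?_, ?_, ?_⟩
  · intro p hp q hq hpq
    obtain ⟨s, -, rfl⟩ := Finset.mem_image.1 hp
    obtain ⟨t, -, rfl⟩ := Finset.mem_image.1 hq
    rw [Finset.disjoint_left]
    intro u hu hu'
    refine hpq ?_
    ext w
    grind
  · ext u
    simp only [Finset.mem_biUnion, Finset.mem_image, Finset.mem_powersetCard_univ, id]
    constructor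
    · rintro ⟨_, ⟨s, hs, rfl⟩, hu⟩
      rcases Finset.mem_insert.1 hu with rfl | hu
      · exact hs
      · rw [Finset.mem_singleton.1 hu]
        by_cases h : M s = s
        · rwa [h]
        · exact (hM.adj s h).2.1
    · exact fun hu => ⟨_, ⟨u, hu, rfl⟩, by simp⟩
  · intro p hp
    obtain ⟨s, -, rfl⟩ := Finset.mem_image.1 hp
    by_cases h : M s = s
    · exact Or.inl ⟨s, by simp [h]⟩
    · exact Or.inr ⟨s, M s, Ne.symm h, (hM.adj s h).2.2.2, rfl⟩

/-- If `0 ≤ k ≤ r - 1` and `n ≥ 2r - k`, and `H` is the `r`-graph with exactly two edges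
intersecting in exactly `k` vertices, then `φ_H^r(K_n^r) = ⌈C(n,r)/2⌉`, where `K_n^r` is
the complete `r`-graph on `n` vertices. -/
theorem phiPair_complete_eq (r k n : ℕ) (hk : k + 1 ≤ r) (hn : 2 * r - k ≤ n) :
    phiPair k (Finset.powersetCard r (Finset.univ : Finset (Fin n))) =
      (n.choose r + 1) / 2 := by
  have hG : (Finset.powersetCard r (Finset.univ : Finset (Fin n))).card = n.choose r := by simp
  obtain ⟨M, hM, huniq⟩ := johnsonGraph.exists_nearPerfect_matching hk hn
  have hP := johnsonGraph.isPairDecomp hM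
  have hle := hP.two_mul_card_le (by
    have key : ∀ e : Finset (Fin n), {e} ∈ ((Finset.powersetCard r
        (Finset.univ : Finset (Fin n))).image fun s => ({s, M s} : Finset (Finset (Fin n)))) →
        e.card = r ∧ M e = e := by
      intro e he
      obtain ⟨s, hs, h⟩ := Finset.mem_image.1 he
      have h1 : s = e := Finset.mem_singleton.1 (h ▸ Finset.mem_insert_self s {M s})
      have h2 : M s = e := Finset.mem_singleton.1 (h ▸ by simp)
      subst h1
      exact ⟨Finset.mem_powersetCard_univ.1 hs, h2⟩
    exact fun e f he hf => huniq e f (key e he).1 (key f hf).1 (key e he).2 (key f hf).2)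
  rw [hG] at hle
  have hphi : phiPair k (Finset.powersetCard r (Finset.univ : Finset (Fin n))) ≤ _ :=
    Nat.sInf_le ⟨_, hP, rfl⟩
  refine le_antisymm (by omega) ?_
  refine le_csInf ⟨_, _, hP, rfl⟩ ?_
  rintro _ ⟨Q, hQ, rfl⟩
  have := hQ.card_le_two_mul
  rw [hG] at this
  omega
end

section
/- Let k ≥ 1 and r ≥ 2 be integers, and let H be the r-uniform hypergraph consisting of exactly k pairwise disjoint edges. If n ≥ kr(k+r−2) + 2r − 1, then φ_H^r(n) = ⌊(1/k)·C(n,r)⌋ + k − 1 if C(n,r) ≡ k−1 (mod k), and φ_H^r(n) = ⌊(1/k)·C(n,r)⌋ + k − 2 otherwise. -/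
/-- `p` is a copy of the `r`-graph `H` consisting of exactly `k` pairwise disjoint edges:
a set of `k` pairwise disjoint edges. -/
def IsMatchingSet (k : ℕ) {n : ℕ} (p : Finset (Finset (Fin n))) : Prop :=
  p.card = k ∧ ∀ e ∈ p, ∀ f ∈ p, e ≠ f → Disjoint e f

/-- A decomposition of the edge set `G` of an `r`-graph into parts `P`, where each part is
either a single edge or a copy of the `r`-graph `H` consisting of `k` pairwise disjoint
edges. -/
def IsMatchingDecomp (k : ℕ) {n : ℕ} (G : Finset (Finset (Fin n)))
    (P : Finset (Finset (Finset (Fin n)))) : Prop :=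
  (∀ p ∈ P, ∀ q ∈ P, p ≠ q → Disjoint p q) ∧
    P.biUnion id = G ∧
    ∀ p ∈ P, (∃ e, p = {e}) ∨ IsMatchingSet k p

/-- `φ_H^r(G)`: the minimum number of parts in an `H`-decomposition of `G`, where `H`
consists of `k` pairwise disjoint edges. -/
noncomputable def phiM (k : ℕ) {n : ℕ} (G : Finset (Finset (Fin n))) : ℕ :=
  sInf {m | ∃ P, IsMatchingDecomp k G P ∧ P.card = m}

/-- `φ_H^r(n)`: the maximum of `φ_H^r(G)` over all `r`-graphs `G` on `n` vertices. -/
noncomputable def phiMMax (r k n : ℕ) : ℕ :=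
  sSup {m | ∃ G : Finset (Finset (Fin n)), (∀ e ∈ G, e.card = r) ∧ phiM k G = m}

section EquitableColouring

open Classical Finset

variable {α ι : Type*} (G : SimpleGraph α) (S : Finset α)

/-- The vertex `v` has no neighbour of colour `c` in `S`. -/
def IsMovable (f : α → ι) (v : α) (c : ι) : Prop :=
  ∀ w ∈ S, f w = c → ¬ G.Adj v w

/-- `f` is a proper colouring of `S`. -/
def IsProperOn (f : α → ι) : Prop :=
  ∀ v ∈ S, ∀ w ∈ S, f v = f w → ¬ G.Adj v w

/-- There is a path of distinct colours of `X` from a given colour to `a`, each colour class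
having a vertex that is movable to the next class. -/
inductive MovePath (f : α → ι) (a : ι) : Finset ι → ι → Prop
  | nil {X : Finset ι} : a ∈ X → MovePath f a X a
  | cons {X : Finset ι} {c : ι} (v : α) (d : ι) : c ∈ X → v ∈ S → f v = c →
      IsMovable G S f v d → MovePath f a (X.erase c) d → MovePath f a X c

variable {G S} {f : α → ι} {a : ι}

lemma MovePath.mem {X : Finset ι} {c : ι} (h : MovePath G S f a X c) : c ∈ X := by
  cases h <;> assumption

lemma MovePath.target_mem {X : Finset ι} {c : ι} (h : MovePath G S f a X c) : a ∈ X := by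
  induction h with
  | nil h => exact h
  | cons v d _ _ _ _ _ ih => exact mem_of_mem_erase ih

lemma MovePath.mono {X Y : Finset ι} {c : ι} (h : MovePath G S f a X c) (hXY : X ⊆ Y) :
    MovePath G S f a Y c := by
  induction h generalizing Y with
  | nil h => exact .nil (hXY h)
  | cons v d hc hv hf hm _ ih => exact .cons v d (hXY hc) hv hf hm (ih (erase_subset_erase _ hXY))

lemma MovePath.or_erase {X : Finset ι} {c : ι} (h : MovePath G S f a X c) (w : ι) :
    MovePath G S f a X w ∨ MovePath G S f a (X.erase w) c := by
  induction h with
  | @nil X h =>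
    by_cases hw : w = a
    · exact .inl (by subst hw; exact .nil h)
    · exact .inr (.nil (mem_erase.2 ⟨Ne.symm hw, h⟩))
  | @cons X c v d hc hv hf hm hp ih =>
    by_cases hw : w = c
    · exact .inl (hw ▸ .cons v d hc hv hf hm hp)
    · rcases ih with h | h
      · exact .inl (h.mono (erase_subset _ _))
      · rw [erase_right_comm] at h
        exact .inr (.cons v d (mem_erase.2 ⟨Ne.symm hw, hc⟩) hv hf hm h)

lemma MovePath.step {X : Finset ι} {c : ι} (h : MovePath G S f a X c) {v : α} (hv : v ∈ S)
    (hX : f v ∈ X) (hm : IsMovable G S f v c) : MovePath G S f a X (f v) := by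
  rcases h.or_erase (f v) with h | h
  · exact h
  · exact .cons v c hX hv rfl hm h

lemma MovePath.restrict {X Y : Finset ι} {c : ι} (h : MovePath G S f a X c)
    (hY : ∀ j, MovePath G S f a X j → j ∈ Y) : MovePath G S f a Y c := by
  induction h generalizing Y with
  | nil h => exact .nil (hY _ (.nil h))
  | @cons X c v d hc hv hf hm hp ih =>
    refine .cons v d (hY _ (.cons v d hc hv hf hm hp)) hv hf hm (ih fun j hj => ?_)
    exact mem_erase.2 ⟨(mem_erase.1 hj.mem).1, hY _ (hj.mono (erase_subset _ _))⟩

lemma MovePath.congr {X : Finset ι} {c : ι} {g : α → ι} (h : MovePath G S f a X c)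
    (hg : ∀ v ∈ S, ∀ j ∈ X, g v = j ↔ f v = j) : MovePath G S g a X c := by
  induction h with
  | nil h => exact .nil h
  | @cons X c v d hc hv hf hm hp ih =>
    refine .cons v d hc hv ((hg v hv c hc).2 hf) (fun w hw hgw => hm w hw ?_)
      (ih fun v hv j hj => hg v hv j (mem_of_mem_erase hj))
    exact (hg w hw d (mem_of_mem_erase hp.mem)).1 hgw

lemma card_filter_update {f : α → ι} {v : α} (hv : v ∈ S) (d j : ι) :
    #{w ∈ S | Function.update f v d w = j} + (if j = f v then 1 else 0) =
      #{w ∈ S | f w = j} + (if j = d then 1 else 0) := by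
  by_cases hd : f v = d
  · subst hd
    rw [Function.update_eq_self]
  have hS : S = insert v (S.erase v) := (insert_erase hv).symm
  have h1 : #{w ∈ S.erase v | Function.update f v d w = j} = #{w ∈ S.erase v | f w = j} := by
    congr 1
    apply filter_congr
    intro w hw
    rw [Function.update_of_ne (ne_of_mem_erase hw)]
  rw [hS, filter_insert, filter_insert]
  simp only [Function.update_self]
  have h2 : v ∉ {w ∈ S.erase v | Function.update f v d w = j} := by simp
  have h3 : v ∉ {w ∈ S.erase v | f w = j} := by simp
  by_cases h4 : d = j
  · subst h4
    simp only [if_true, if_neg hd, if_neg (Ne.symm hd), card_insert_of_notMem h2, h1]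
  · by_cases h5 : f v = j
    · subst h5
      simp only [if_true, if_neg h4, if_neg hd, card_insert_of_notMem h3, h1]
    · simp only [if_neg h4, if_neg h5, if_neg (Ne.symm h4), if_neg (Ne.symm h5), h1]

lemma IsProperOn.update_insert {v : α}
    (hf : ∀ x ∈ S, ∀ y ∈ S, x ≠ v → y ≠ v → f x = f y → ¬ G.Adj x y)
    {d : ι} (hm : IsMovable G S f v d) : IsProperOn G (insert v S) (Function.update f v d) := by
  intro x hx y hy hxy hadj
  by_cases hxv : x = v
  · subst hxv
    have hyx : y ≠ x := hadj.ne'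
    rw [Function.update_self, Function.update_of_ne hyx] at hxy
    exact hm y (mem_of_mem_insert_of_ne hy hyx) hxy.symm hadj
  · have hxS := mem_of_mem_insert_of_ne hx hxv
    by_cases hyv : y = v
    · subst hyv
      rw [Function.update_self, Function.update_of_ne hxv] at hxy
      exact hm x hxS hxy hadj.symm
    · rw [Function.update_of_ne hxv, Function.update_of_ne hyv] at hxy
      exact hf x hxS y (mem_of_mem_insert_of_ne hy hyv) hxv hyv hxy hadj

lemma IsProperOn.update (hf : IsProperOn G S f) {v : α} {d : ι} (hm : IsMovable G S f v d) :
    IsProperOn G S (Function.update f v d) := fun x hx y hy =>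
  IsProperOn.update_insert (fun x hx y hy _ _ => hf x hx y hy) hm x (mem_insert_of_mem hx) y
    (mem_insert_of_mem hy)

/-- Shifting one vertex along every step of a path of colours. -/
lemma MovePath.shift {X : Finset ι} {c : ι} (h : MovePath G S f a X c) (hf : IsProperOn G S f) :
    ∃ g : α → ι, IsProperOn G S g ∧ (∀ v, f v ∉ X → g v = f v) ∧ (∀ v, f v ∈ X → g v ∈ X) ∧
      (∀ v, g v = c → f v = c) ∧
      ∀ j, #{w ∈ S | g w = j} + (if j = c then 1 else 0) =
        #{w ∈ S | f w = j} + (if j = a then 1 else 0) := by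
  induction h with
  | nil h => exact ⟨f, hf, fun _ _ => rfl, fun _ h => h, fun _ h => h, fun _ => rfl⟩
  | @cons X c v d hc hv hfv hm hp ih =>
    obtain ⟨g, hg, hg1, hg2, hg3, hg4⟩ := ih
    have hdc : d ≠ c := (mem_erase.1 hp.mem).1
    have hgv : g v = c := by rw [hg1 v (by simp [hfv]), hfv]
    have hmg : IsMovable G S g v d := fun w hw hgw => hm w hw (hg3 w hgw)
    refine ⟨Function.update g v d, hg.update hmg, ?_, ?_, ?_, ?_⟩
    · intro w hw
      have hwv : w ≠ v := by rintro rfl; exact hw (hfv ▸ hc)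
      rw [Function.update_of_ne hwv, hg1 w fun h => hw (mem_of_mem_erase h)]
    · intro w hw
      by_cases hwv : w = v
      · subst hwv
        rw [Function.update_self]
        exact mem_of_mem_erase hp.mem
      · rw [Function.update_of_ne hwv]
        by_cases hwc : f w ∈ X.erase c
        · exact mem_of_mem_erase (hg2 w hwc)
        · rwa [hg1 w hwc]
    · intro w hw
      by_cases hwv : w = v
      · subst hwv; exact hfv
      · rw [Function.update_of_ne hwv] at hw
        by_contra hwc
        by_cases hwX : f w ∈ X.erase c
        · exact (mem_erase.1 (hg2 w hwX)).1 hw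
        · rw [hg1 w hwX] at hw
          exact hwc hw
    · intro j
      have h1 := card_filter_update hv (f := g) d j
      have h2 := hg4 j
      rw [hgv] at h1
      omega


/-- The colours from which `a` can be reached. -/
noncomputable def accessible (G : SimpleGraph α) (S : Finset α) (f : α → ι) (a : ι)
    (K : Finset ι) : Finset ι :=
  {c ∈ K | MovePath G S f a K c}

lemma mem_accessible {K : Finset ι} {c : ι} :
    c ∈ accessible G S f a K ↔ MovePath G S f a K c := by
  simp only [accessible, mem_filter, and_iff_right_iff_imp]
  exact MovePath.mem

/-- A nonempty family of terminal colours whose vertices are movable to at most one accessible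
colour outside of the family. -/
lemma exists_terminal {K : Finset ι} (ha : a ∈ K)
    (h2 : ∃ c ∈ accessible G S f a K, c ≠ a) :
    ∃ T ⊆ accessible G S f a K, T.Nonempty ∧ a ∉ T ∧
      (∀ w ∈ T, ∀ c ∈ accessible G S f a K, c ≠ w → MovePath G S f a (K.erase w) c) ∧
      ∃ u ∈ accessible G S f a K, u ∉ T ∧ ∀ v ∈ S, f v ∈ T →
        ∀ c ∈ accessible G S f a K, c ∉ T → c ≠ u → ¬ IsMovable G S f v c := by
  set A := accessible G S f a K with hA
  let T : ι → Finset ι := fun u => {c ∈ A | c ≠ u ∧ ¬ MovePath G S f a (K.erase u) c}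
  have haA : a ∈ A := mem_accessible.2 (.nil ha)
  have hne : ({u ∈ A | (T u).Nonempty} : Finset ι).Nonempty := by
    obtain ⟨c, hc, hca⟩ := h2
    refine ⟨a, mem_filter.2 ⟨haA, c, mem_filter.2 ⟨hc, hca, fun h => ?_⟩⟩⟩
    exact (mem_erase.1 h.target_mem).1 rfl
  obtain ⟨u, hu, hmin⟩ := exists_min_image _ (fun u => #(T u)) hne
  obtain ⟨huA, huT⟩ := mem_filter.1 hu
  have haT : a ∉ T u := by
    intro h
    obtain ⟨_, h1, h2⟩ := mem_filter.1 h
    exact h2 (.nil (mem_erase.2 ⟨h1, ha⟩))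
  refine ⟨T u, filter_subset _ _, huT, haT, ?_, u, huA, by simp [T], ?_⟩
  · intro w hw c hc hcw
    by_contra hcon
    obtain ⟨hwA, hwu, hw2⟩ := mem_filter.1 hw
    have hsub : T w ⊆ T u := by
      intro x hx
      obtain ⟨hxA, hxw, hx2⟩ := mem_filter.1 hx
      refine mem_filter.2 ⟨hxA, ?_, ?_⟩
      · rintro rfl
        apply hx2
        have hp := mem_accessible.1 hxA
        cases hp with
        | nil h => exact .nil (mem_erase.2 ⟨hxw, h⟩)
        | cons v d hc hv hf hm hp =>
          rcases hp.or_erase w with h | h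
          · exact absurd h hw2
          · rw [erase_right_comm] at h
            exact .cons v d (mem_erase.2 ⟨hxw, hc⟩) hv hf hm h
      · intro h
        rcases h.or_erase w with h | h
        · exact hw2 h
        · exact hx2 (h.mono (erase_subset_erase _ (erase_subset _ _)))
    have hss : T w ⊂ T u := by
      refine (ssubset_iff_of_subset hsub).2 ⟨w, hw, by simp [T]⟩
    have := hmin w (mem_filter.2 ⟨hwA, c, mem_filter.2 ⟨hc, hcw, hcon⟩⟩)
    exact absurd (card_lt_card hss) (by omega)
  · intro v hv hvT c hc hcT hcu hm
    obtain ⟨hvA, hvu, hv2⟩ := mem_filter.1 hvT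
    have hp : MovePath G S f a (K.erase u) c := by
      by_contra h
      exact hcT (mem_filter.2 ⟨hc, hcu, h⟩)
    exact hv2 (hp.step hv (mem_erase.2 ⟨hvu, (mem_accessible.1 hvA).mem⟩) hm)

/-- `z` is the only neighbour of `y` in the colour class of `z`. -/
def IsSolo (G : SimpleGraph α) (S : Finset α) (f : α → ι) (z y : α) : Prop :=
  G.Adj y z ∧ ∀ w ∈ S, f w = f z → G.Adj y w → w = z

lemma one_le_card_of_not_isMovable {v : α} {c : ι} (h : ¬ IsMovable G S f v c) :
    1 ≤ #{w ∈ S | f w = c ∧ G.Adj v w} := by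
  unfold IsMovable at h
  push Not at h
  obtain ⟨w, hw, h1, h2⟩ := h
  exact card_pos.2 ⟨w, mem_filter.2 ⟨hw, h1, h2⟩⟩

lemma sum_card_adj_eq (P : Finset ι) (v : α) :
    ∑ j ∈ P, #{w ∈ S | f w = j ∧ G.Adj v w} = #{w ∈ S | f w ∈ P ∧ G.Adj v w} := by
  rw [card_eq_sum_card_fiberwise (f := f) (t := P)
    (fun w hw => (mem_filter.1 hw).2.1)]
  refine sum_congr rfl fun j hj => ?_
  rw [filter_filter]
  congr 1
  apply filter_congr
  intro w _
  constructor
  · rintro ⟨rfl, h⟩; exact ⟨⟨hj, h⟩, rfl⟩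
  · rintro ⟨⟨_, h⟩, rfl⟩; exact ⟨rfl, h⟩

lemma card_adj_add_card_adj (A : Finset ι) (v : α) :
    ∑ j ∈ A, #{w ∈ S | f w = j ∧ G.Adj v w} + #{w ∈ S | f w ∉ A ∧ G.Adj v w} =
      #{w ∈ S | G.Adj v w} := by
  rw [sum_card_adj_eq, ← card_filter_add_card_filter_not (s := {w ∈ S | G.Adj v w})
    (fun w => f w ∈ A), filter_filter, filter_filter]
  simp only [and_comm]

section Counting

variable {K A T : Finset ι} {s : ℕ} {u : ι}

/-- If no solo vertex of a class `w` is movable within `A`, then `T` is large. -/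
lemma card_sdiff_lt_card (hA : A ⊆ K) (hT : T ⊆ A)
    (hdeg : ∀ v ∈ S, #{w ∈ S | G.Adj v w} < #K)
    (hB : ∀ y ∈ S, f y ∉ A → ∀ c ∈ A, ¬ IsMovable G S f y c)
    (hu : ∀ v ∈ S, f v ∈ T → ∀ c ∈ A, c ∉ T → c ≠ u → ¬ IsMovable G S f v c)
    (hcard : #{v ∈ S | f v ∉ A} = #(K \ A) * s + 1)
    {w : ι} (hw : w ∈ T) (hws : #{v ∈ S | f v = w} = s)
    (hsolo : ∀ z ∈ S, f z = w → ∀ y ∈ S, f y ∉ A → IsSolo G S f z y →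
      ∀ c ∈ A, c ≠ w → ¬ IsMovable G S f z c) : #(K \ A) < #T := by
  have hKA : #(K \ A) + #A = #K := card_sdiff_add_card_eq_card hA
  have hTA : #T ≤ #A := card_le_card hT
  let B : Finset α := {v ∈ S | f v ∉ A}
  let Q : α → Prop := fun z => ∃ y ∈ B, IsSolo G S f z y
  let C : Finset α := {v ∈ S | f v = w}
  have hBS : ∀ z, #{y ∈ B | G.Adj y z} = #{y ∈ S | f y ∉ A ∧ G.Adj z y} := by
    intro z
    rw [filter_filter]
    simp only [G.adj_comm]
  have hz1 : ∀ z ∈ C, Q z → #{y ∈ B | G.Adj y z} ≤ #(K \ A) := by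
    intro z hz ⟨y, hy, hyz⟩
    obtain ⟨hzS, hzw⟩ := mem_filter.1 hz
    obtain ⟨hyS, hyA⟩ := mem_filter.1 hy
    have h1 := card_adj_add_card_adj (f := f) (S := S) (G := G) A z
    have h2 := hdeg z hzS
    have h3 : #(A.erase w) ≤ ∑ j ∈ A, #{x ∈ S | f x = j ∧ G.Adj z x} := by
      rw [card_eq_sum_ones]
      refine le_trans (sum_le_sum fun c hc => ?_) (sum_le_sum_of_subset (erase_subset w A))
      exact one_le_card_of_not_isMovable (hsolo z hzS hzw y hyS hyA hyz c (mem_of_mem_erase hc)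
        (ne_of_mem_erase hc))
    rw [card_erase_of_mem (hT hw)] at h3
    have := card_pos.2 ⟨w, hT hw⟩
    rw [hBS]
    omega
  have hz2 : ∀ z ∈ C, #{y ∈ B | G.Adj y z} ≤ #(K \ A) + #T := by
    intro z hz
    obtain ⟨hzS, hzw⟩ := mem_filter.1 hz
    have h1 := card_adj_add_card_adj (f := f) (S := S) (G := G) A z
    have h2 := hdeg z hzS
    have h3 : #((A \ T).erase u) ≤ ∑ j ∈ A, #{x ∈ S | f x = j ∧ G.Adj z x} := by
      rw [card_eq_sum_ones]
      refine le_trans (sum_le_sum fun c hc => ?_)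
        (sum_le_sum_of_subset ((erase_subset u _).trans sdiff_subset))
      obtain ⟨hcu, hc⟩ := mem_erase.1 hc
      exact one_le_card_of_not_isMovable (hu z hzS (hzw ▸ hw) c (mem_sdiff.1 hc).1
        (mem_sdiff.1 hc).2 hcu)
    have h4 := pred_card_le_card_erase (s := A \ T) (a := u)
    have h5 : #(A \ T) + #T = #A := card_sdiff_add_card_eq_card hT
    rw [hBS]
    omega
  have hy : ∀ y ∈ B, 2 ≤ ∑ z ∈ C, if G.Adj y z then (if Q z then 2 else 1) else 0 := by
    intro y hy
    obtain ⟨hyS, hyA⟩ := mem_filter.1 hy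
    rw [← sum_filter]
    have h1 : 1 ≤ #{z ∈ C | G.Adj y z} := by
      have := one_le_card_of_not_isMovable (hB y hyS hyA w (hT hw))
      rwa [filter_filter]
    rcases h1.eq_or_lt with h1 | h1
    · obtain ⟨z, hz⟩ := card_eq_one.1 h1.symm
      have hz' : z ∈ {z ∈ C | G.Adj y z} := by rw [hz]; simp
      obtain ⟨hzC, hyz⟩ := mem_filter.1 hz'
      have hQ : Q z := by
        refine ⟨y, hy, hyz, fun x hx hxz hyx => ?_⟩
        have : x ∈ {z ∈ C | G.Adj y z} :=
          mem_filter.2 ⟨mem_filter.2 ⟨hx, hxz.trans (mem_filter.1 hzC).2⟩, hyx⟩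
        rw [hz] at this
        exact mem_singleton.1 this
      rw [hz, sum_singleton, if_pos hQ]
    · refine le_trans h1 ?_
      rw [card_eq_sum_ones]
      refine sum_le_sum fun z _ => ?_
      split_ifs <;> omega
  have htot : #B * 2 ≤ ∑ z ∈ C, if Q z then 2 * #(K \ A) else #(K \ A) + #T := by
    calc #B * 2 ≤ ∑ y ∈ B, ∑ z ∈ C, if G.Adj y z then (if Q z then 2 else 1) else 0 := by
          rw [← smul_eq_mul]; exact card_nsmul_le_sum _ _ _ hy
      _ = ∑ z ∈ C, ∑ y ∈ B, if G.Adj y z then (if Q z then 2 else 1) else 0 := sum_comm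
      _ ≤ _ := by
          refine sum_le_sum fun z hz => ?_
          rw [← sum_filter, sum_const, smul_eq_mul]
          by_cases hQ : Q z
          · rw [if_pos hQ, if_pos hQ, mul_comm]
            exact Nat.mul_le_mul_left _ (hz1 z hz hQ)
          · rw [if_neg hQ, if_neg hQ, mul_one]
            exact hz2 z hz
  by_contra hcon
  have h1 : ∑ z ∈ C, (if Q z then 2 * #(K \ A) else #(K \ A) + #T) ≤ s * (2 * #(K \ A)) := by
    have := sum_le_card_nsmul C (fun z => if Q z then 2 * #(K \ A) else #(K \ A) + #T)
      (2 * #(K \ A)) fun z _ => by split_ifs <;> omega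
    rwa [show #C = s from hws, smul_eq_mul] at this
  have h2 : #B = #(K \ A) * s + 1 := hcard
  rw [h2] at htot
  nlinarith [htot.trans h1]

lemma exists_solo_pair (hK : ∀ v ∈ S, f v ∈ K) (hA : A ⊆ K) (hT : T ⊆ A) (hTne : T.Nonempty)
    (hdeg : ∀ v ∈ S, #{w ∈ S | G.Adj v w} < #K)
    (hB : ∀ y ∈ S, f y ∉ A → ∀ c ∈ A, ¬ IsMovable G S f y c)
    (hu : ∀ v ∈ S, f v ∈ T → ∀ c ∈ A, c ∉ T → c ≠ u → ¬ IsMovable G S f v c)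
    (hcard : #{v ∈ S | f v ∉ A} = #(K \ A) * s + 1)
    (hs : ∀ w ∈ T, #{v ∈ S | f v = w} = s)
    (hsolo : ∀ z ∈ S, f z ∈ T → ∀ y ∈ S, f y ∉ A → IsSolo G S f z y →
      ∀ c ∈ A, c ≠ f z → ¬ IsMovable G S f z c) :
    ∃ z ∈ S, f z ∈ T ∧ ∃ y₁ ∈ S, ∃ y₂ ∈ S, f y₁ ∉ A ∧ f y₂ ∉ A ∧ y₁ ≠ y₂ ∧ ¬ G.Adj y₁ y₂ ∧
      IsSolo G S f z y₁ ∧ IsSolo G S f z y₂ := by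
  have hKA : #(K \ A) + #A = #K := card_sdiff_add_card_eq_card hA
  have hTA : #T ≤ #A := card_le_card hT
  have hlt : #(K \ A) < #T := by
    obtain ⟨w, hw⟩ := hTne
    exact card_sdiff_lt_card hA hT hdeg hB hu hcard hw (hs w hw)
      fun z hz hzw y hy hyA hzy c hc hcw =>
        hsolo z hz (hzw ▸ hw) y hy hyA hzy c hc (hzw ▸ hcw)
  by_contra! hcon
  let B : Finset α := {v ∈ S | f v ∉ A}
  let C : Finset α := {v ∈ S | f v ∈ T}
  let D : α → ℕ := fun y => #{x ∈ S | f x ∉ A ∧ G.Adj y x}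
  have hBpos : 0 < #(K \ A) := by
    have : 0 < #B := by change 0 < #{v ∈ S | f v ∉ A}; omega
    obtain ⟨y, hy⟩ := card_pos.1 this
    obtain ⟨hyS, hyA⟩ := mem_filter.1 hy
    exact card_pos.2 ⟨f y, mem_sdiff.2 ⟨hK y hyS, hyA⟩⟩
  have hC : #C = #T * s := by
    rw [card_eq_sum_card_fiberwise (s := C) (f := f) (t := T)
      (fun w hw => (mem_filter.1 hw).2), ← smul_eq_mul]
    refine sum_eq_card_nsmul fun j hj => ?_
    rw [← hs j hj, filter_filter]
    congr 1
    apply filter_congr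
    intro v _
    constructor
    · exact fun h => h.2
    · exact fun h => ⟨h ▸ hj, h⟩
  have hDlt : ∀ y ∈ B, D y + 1 ≤ #(K \ A) := by
    intro y hy
    obtain ⟨hyS, hyA⟩ := mem_filter.1 hy
    have h1 := card_adj_add_card_adj (f := f) (S := S) (G := G) A y
    have h2 := hdeg y hyS
    have h3 : #A ≤ ∑ j ∈ A, #{x ∈ S | f x = j ∧ G.Adj y x} := by
      rw [card_eq_sum_ones]
      exact sum_le_sum fun c hc => one_le_card_of_not_isMovable (hB y hyS hyA c hc)
    change #{x ∈ S | f x ∉ A ∧ G.Adj y x} + 1 ≤ _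
    omega
  have hsolos : ∀ y ∈ B, D y + 1 + #T ≤ #(K \ A) + #{z ∈ C | IsSolo G S f z y} := by
    intro y hy
    obtain ⟨hyS, hyA⟩ := mem_filter.1 hy
    have h1 := card_adj_add_card_adj (f := f) (S := S) (G := G) A y
    have h2 := hdeg y hyS
    let P : Finset ι := {j ∈ T | #{x ∈ S | f x = j ∧ G.Adj y x} = 1}
    have hP : #P ≤ #{z ∈ C | IsSolo G S f z y} := by
      have : ∀ j ∈ P, ∃ z ∈ C, IsSolo G S f z y ∧ f z = j := by
        intro j hj
        obtain ⟨hjT, hj1⟩ := mem_filter.1 hj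
        obtain ⟨z, hz⟩ := card_eq_one.1 hj1
        have hz' : z ∈ {x ∈ S | f x = j ∧ G.Adj y x} := by rw [hz]; simp
        obtain ⟨hzS, hzj, hyz⟩ := mem_filter.1 hz'
        refine ⟨z, mem_filter.2 ⟨hzS, hzj ▸ hjT⟩, ⟨hyz, fun x hx hxz hyx => ?_⟩, hzj⟩
        have : x ∈ {x ∈ S | f x = j ∧ G.Adj y x} := mem_filter.2 ⟨hx, hxz.trans hzj, hyx⟩
        rw [hz] at this
        exact mem_singleton.1 this
      calc #P ≤ #(({z ∈ C | IsSolo G S f z y}).image f) := by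
            refine card_le_card fun j hj => ?_
            obtain ⟨z, hzC, hz, hzj⟩ := this j hj
            exact mem_image.2 ⟨z, mem_filter.2 ⟨hzC, hz⟩, hzj⟩
        _ ≤ _ := card_image_le
    have h3 : #A + #(T \ P) ≤ ∑ j ∈ A, #{x ∈ S | f x = j ∧ G.Adj y x} := by
      have hsub : T \ P ⊆ A := sdiff_subset.trans hT
      have : #A + #(T \ P) = ∑ j ∈ A, (1 + if j ∈ T \ P then 1 else 0) := by
        rw [sum_add_distrib, ← card_eq_sum_ones, ← sum_filter, filter_mem_eq_inter,
          inter_eq_right.2 hsub, ← card_eq_sum_ones]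
      rw [this]
      refine sum_le_sum fun c hc => ?_
      have h4 := one_le_card_of_not_isMovable (hB y hyS hyA c hc)
      split_ifs with h5
      · obtain ⟨h5, h6⟩ := mem_sdiff.1 h5
        have : #{x ∈ S | f x = c ∧ G.Adj y x} ≠ 1 := fun h => h6 (mem_filter.2 ⟨h5, h⟩)
        omega
      · omega
    have h5 : #(T \ P) + #P = #T := card_sdiff_add_card_eq_card (filter_subset _ _)
    change #{x ∈ S | f x ∉ A ∧ G.Adj y x} + 1 + _ ≤ _
    omega
  have hclique : ∀ y ∈ B, ∀ z ∈ C, IsSolo G S f z y →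
      #{x ∈ B | IsSolo G S f z x} ≤ D y + 1 := by
    intro y hy z hz hzy
    obtain ⟨hyS, hyA⟩ := mem_filter.1 hy
    obtain ⟨hzS, hzT⟩ := mem_filter.1 hz
    calc #{x ∈ B | IsSolo G S f z x} ≤ #(insert y {x ∈ S | f x ∉ A ∧ G.Adj y x}) := by
          refine card_le_card fun x hx => ?_
          obtain ⟨hxB, hx⟩ := mem_filter.1 hx
          obtain ⟨hxS, hxA⟩ := mem_filter.1 hxB
          by_cases hxy : x = y
          · exact mem_insert.2 (.inl hxy)
          · refine mem_insert.2 (.inr (mem_filter.2 ⟨hxS, hxA, ?_⟩))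
            by_contra hadj
            exact hcon z hzS hzT y hyS x hxS hyA hxA (Ne.symm hxy) hadj hzy hx
      _ ≤ _ := card_insert_le _ _
  let μ : α → ℚ := fun z => (#{x ∈ B | IsSolo G S f z x} : ℚ)⁻¹
  have hup : ∑ z ∈ C, ∑ y ∈ B, (if IsSolo G S f z y then μ z else 0) ≤ #C := by
    rw [← nsmul_one, ← sum_const]
    refine sum_le_sum fun z _ => ?_
    rw [← sum_filter, sum_const, nsmul_eq_mul]
    exact mul_inv_le_one
  have hlow : (#B : ℚ) * ((#T : ℚ) / #(K \ A)) ≤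
      ∑ y ∈ B, ∑ z ∈ C, (if IsSolo G S f z y then μ z else 0) := by
    rw [← nsmul_eq_mul]
    refine card_nsmul_le_sum _ _ _ fun y hy => ?_
    rw [← sum_filter]
    have h1 : (#{z ∈ C | IsSolo G S f z y} : ℚ) * ((D y + 1 : ℕ) : ℚ)⁻¹ ≤
        ∑ z ∈ C with IsSolo G S f z y, μ z := by
      rw [← nsmul_eq_mul]
      refine card_nsmul_le_sum _ _ _ fun z hz => ?_
      obtain ⟨hzC, hz⟩ := mem_filter.1 hz
      refine inv_anti₀ ?_ (by exact_mod_cast hclique y hy z hzC hz)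
      exact_mod_cast card_pos.2 ⟨y, mem_filter.2 ⟨hy, hz⟩⟩
    refine le_trans ?_ h1
    rw [← div_eq_mul_inv, div_le_div_iff₀ (by exact_mod_cast hBpos) (by positivity)]
    have h2 := hsolos y hy
    have h3 := hDlt y hy
    norm_cast
    set σ := #{z ∈ C | IsSolo G S f z y}
    set c := D y + 1
    set β := #(K \ A)
    zify at *
    nlinarith [mul_nonneg (sub_nonneg.2 h3) (sub_nonneg.2 hlt.le)]
  rw [sum_comm] at hup
  have h1 := hlow.trans hup
  have h2 : #B = #(K \ A) * s + 1 := hcard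
  rw [h2, hC, ← mul_div_assoc, div_le_iff₀ (by exact_mod_cast hBpos)] at h1
  norm_cast at h1
  have : 0 < #T := by omega
  nlinarith

end Counting

/-- `g` is a proper colouring of `S` by the colours of `K`, each used exactly `s` times. -/
def IsEquitableOn (G : SimpleGraph α) (S : Finset α) (K : Finset ι) (s : ℕ) (g : α → ι) : Prop :=
  IsProperOn G S g ∧ (∀ v ∈ S, g v ∈ K) ∧ ∀ j ∈ K, #{v ∈ S | g v = j} = s

lemma IsProperOn.glue {S₁ S₂ : Finset α} {A : Finset ι} {p g : α → ι} (hp : IsProperOn G S₁ p)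
    (hg : IsProperOn G S₂ g) (hpA : ∀ v ∈ S₁, p v ∈ A) (hgA : ∀ v ∈ S₂, g v ∉ A) :
    IsProperOn G (S₁ ∪ S₂) (fun v => if v ∈ S₂ then g v else p v) := by
  intro v hv w hw hvw
  by_cases h1 : v ∈ S₂ <;> by_cases h2 : w ∈ S₂ <;> simp only [h1, h2, if_true, if_false] at hvw
  · exact hg v h1 w h2 hvw
  · have := hpA w ((mem_union.1 hw).resolve_right h2)
    exact absurd (hvw ▸ this) (hgA v h1)
  · have := hpA v ((mem_union.1 hv).resolve_right h1)
    exact absurd (hvw ▸ this) (hgA w h2)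
  · exact hp v ((mem_union.1 hv).resolve_right h1) w ((mem_union.1 hw).resolve_right h2) hvw

lemma IsEquitableOn.glue {S₁ S₂ : Finset α} {K A : Finset ι} {s : ℕ} {p g : α → ι}
    (hp : IsEquitableOn G S₁ A s p) (hg : IsEquitableOn G S₂ (K \ A) s g) (hA : A ⊆ K)
    (hS : Disjoint S₁ S₂) :
    IsEquitableOn G (S₁ ∪ S₂) K s (fun v => if v ∈ S₂ then g v else p v) := by
  have hgA : ∀ v ∈ S₂, g v ∉ A := fun v hv => (mem_sdiff.1 (hg.2.1 v hv)).2
  refine ⟨hp.1.glue hg.1 hp.2.1 hgA, fun v hv => ?_, fun j hj => ?_⟩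
  · dsimp only
    split_ifs with h
    · exact (mem_sdiff.1 (hg.2.1 v h)).1
    · exact hA (hp.2.1 v ((mem_union.1 hv).resolve_right h))
  · by_cases hjA : j ∈ A
    · rw [← hp.2.2 j hjA]
      congr 1
      ext v
      simp only [mem_filter, mem_union]
      constructor
      · rintro ⟨hv, hvj⟩
        by_cases h : v ∈ S₂
        · rw [if_pos h] at hvj
          exact absurd (hvj ▸ hjA) (hgA v h)
        · rw [if_neg h] at hvj
          exact ⟨hv.resolve_right h, hvj⟩
      · rintro ⟨hv, hvj⟩
        rw [if_neg (disjoint_left.1 hS hv)]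
        exact ⟨.inl hv, hvj⟩
    · rw [← hg.2.2 j (mem_sdiff.2 ⟨hj, hjA⟩)]
      congr 1
      ext v
      simp only [mem_filter, mem_union]
      constructor
      · rintro ⟨hv, hvj⟩
        by_cases h : v ∈ S₂
        · rw [if_pos h] at hvj
          exact ⟨h, hvj⟩
        · rw [if_neg h] at hvj
          exact absurd (hvj ▸ hp.2.1 v (hv.resolve_right h)) hjA
      · rintro ⟨hv, hvj⟩
        rw [if_pos hv]
        exact ⟨.inr hv, hvj⟩

/-- A proper colouring by `K` whose classes have size `s`, except that the class of `a` is one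
smaller and the class of `b` is one larger. -/
def IsNearlyEquitableOn (G : SimpleGraph α) (S : Finset α) (K : Finset ι) (s : ℕ) (f : α → ι)
    (a b : ι) : Prop :=
  IsProperOn G S f ∧ (∀ v ∈ S, f v ∈ K) ∧
    ∀ j ∈ K, #{v ∈ S | f v = j} + (if j = a then 1 else 0) = s + (if j = b then 1 else 0)

lemma not_isMovable_accessible {K : Finset ι} (hK : ∀ v ∈ S, f v ∈ K) {y : α} (hy : y ∈ S)
    (hyA : f y ∉ accessible G S f a K) {c : ι} (hc : c ∈ accessible G S f a K) :
    ¬ IsMovable G S f y c := fun hm =>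
  hyA (mem_accessible.2 ((mem_accessible.1 hc).step hy (hK y hy) hm))

lemma accessible_subset {K : Finset ι} : accessible G S f a K ⊆ K := filter_subset _ _

lemma exists_isMovable {P : Finset ι} {v : α} (h : #{w ∈ S | G.Adj v w} < #P) :
    ∃ d ∈ P, IsMovable G S f v d := by
  by_contra! hcon
  have h1 : #P ≤ ∑ j ∈ P, #{w ∈ S | f w = j ∧ G.Adj v w} := by
    rw [card_eq_sum_ones]
    exact sum_le_sum fun c hc => one_le_card_of_not_isMovable (hcon c hc)
  rw [sum_card_adj_eq] at h1
  have h2 : #{w ∈ S | f w ∈ P ∧ G.Adj v w} ≤ #{w ∈ S | G.Adj v w} :=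
    card_le_card (monotone_filter_right _ fun w _ h => h.2)
  omega

section Near

variable {K : Finset ι} {s : ℕ} {b : ι}

lemma IsNearlyEquitableOn.exists_of_movePath (hf : IsNearlyEquitableOn G S K s f a b)
    (hb : MovePath G S f a K b) : ∃ g, IsEquitableOn G S K s g := by
  obtain ⟨hf1, hf2, hf3⟩ := hf
  obtain ⟨g, hg1, -, hg2, -, hg3⟩ := hb.shift hf1
  refine ⟨g, hg1, fun v hv => hg2 v (hf2 v hv), fun j hj => ?_⟩
  have h1 := hg3 j
  have h2 := hf3 j hj
  omega

lemma IsNearlyEquitableOn.card_inaccessible (hf : IsNearlyEquitableOn G S K s f a b) (ha : a ∈ K)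
    (hbK : b ∈ K) (hb : ¬ MovePath G S f a K b) :
    #{v ∈ S | f v ∉ accessible G S f a K} = #(K \ accessible G S f a K) * s + 1 := by
  set A := accessible G S f a K
  obtain ⟨hf1, hf2, hf3⟩ := hf
  have hbA : b ∈ K \ A := mem_sdiff.2 ⟨hbK, fun h => hb (mem_accessible.1 h)⟩
  have haA : a ∈ A := mem_accessible.2 (.nil ha)
  rw [card_eq_sum_card_fiberwise (s := {v ∈ S | f v ∉ A}) (f := f) (t := K \ A) fun v hv =>
    mem_sdiff.2 ⟨hf2 v (mem_filter.1 hv).1, (mem_filter.1 hv).2⟩]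
  have : ∀ j ∈ K \ A, #{v ∈ {v ∈ S | f v ∉ A} | f v = j} = s + if j = b then 1 else 0 := by
    intro j hj
    obtain ⟨hjK, hjA⟩ := mem_sdiff.1 hj
    have h1 := hf3 j hjK
    rw [if_neg (by rintro rfl; exact hjA haA), add_zero] at h1
    rw [← h1, filter_filter]
    congr 1
    apply filter_congr
    intro v _
    constructor
    · exact fun h => h.2
    · exact fun h => ⟨h ▸ hjA, h⟩
  rw [sum_congr rfl this, sum_add_distrib, sum_const, sum_ite_eq' (K \ A) b, if_pos hbA,
    smul_eq_mul]

lemma IsNearlyEquitableOn.exists_accessible_ne (hf : IsNearlyEquitableOn G S K s f a b)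
    (ha : a ∈ K) (hbK : b ∈ K) (hb : ¬ MovePath G S f a K b)
    (hdeg : ∀ v ∈ S, #{w ∈ S | G.Adj v w} < #K) :
    ∃ c ∈ accessible G S f a K, c ≠ a := by
  by_contra! hcon
  have hcard := hf.card_inaccessible ha hbK hb
  have hB := fun y hy hyA => not_isMovable_accessible (G := G) (a := a) hf.2.1 (y := y) hy hyA
    (c := a) (mem_accessible.2 (.nil ha))
  have hA : accessible G S f a K = {a} :=
    eq_singleton_iff_unique_mem.2 ⟨mem_accessible.2 (.nil ha), hcon⟩
  have hKA : #(K \ accessible G S f a K) + 1 = #K := by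
    have := card_sdiff_add_card_eq_card (accessible_subset (G := G) (S := S) (f := f) (a := a)
      (K := K))
    rwa [hA, card_singleton, ← hA] at this
  set A := accessible G S f a K
  have hab : a ≠ b := by rintro rfl; exact hb (.nil ha)
  have h1 := hf.2.2 a ha
  rw [if_pos rfl, if_neg hab, add_zero] at h1
  have h2 : #{v ∈ S | f v ∉ A} ≤ #{v ∈ S | f v = a} * #(K \ A) := by
    refine (card_le_card fun y hy => ?_).trans (card_biUnion_le_card_mul _
      (fun v => {w ∈ S | G.Adj v w}) _ fun v hv => ?_)
    · obtain ⟨hyS, hyA⟩ := mem_filter.1 hy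
      have := hB y hyS hyA
      unfold IsMovable at this
      push Not at this
      obtain ⟨w, hw, hwa, hadj⟩ := this
      exact mem_biUnion.2 ⟨w, mem_filter.2 ⟨hw, hwa⟩, mem_filter.2 ⟨hyS, hadj.symm⟩⟩
    · have := hdeg v (mem_filter.1 hv).1
      omega
  rw [hcard, ← h1] at h2
  nlinarith

lemma card_adj_inaccessible_lt (hK : ∀ v ∈ S, f v ∈ K)
    (hdeg : ∀ v ∈ S, #{w ∈ S | G.Adj v w} < #K) {y : α} (hy : y ∈ S)
    (hyA : f y ∉ accessible G S f a K) :
    #{w ∈ S | f w ∉ accessible G S f a K ∧ G.Adj y w} < #(K \ accessible G S f a K) := by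
  have h0 := card_sdiff_add_card_eq_card (accessible_subset (G := G) (S := S) (f := f) (a := a)
      (K := K))
  set A := accessible G S f a K
  have h1 := card_adj_add_card_adj (f := f) (S := S) (G := G) A y
  have h2 := hdeg y hy
  have h3 : #A ≤ ∑ j ∈ A, #{x ∈ S | f x = j ∧ G.Adj y x} := by
    rw [card_eq_sum_ones]
    exact sum_le_sum fun c hc => one_le_card_of_not_isMovable
      (not_isMovable_accessible hK hy hyA hc)
  omega

/-- If a solo vertex `z` of a terminal class is movable within the accessible classes, then the
accessible part and a solo neighbour of `z` have an equitable colouring. -/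
lemma IsNearlyEquitableOn.exists_of_isMovable (hf : IsNearlyEquitableOn G S K s f a b)
    (hb : ¬ MovePath G S f a K b) {z y : α} {c : ι} (hz : z ∈ S)
    (hyA : f y ∉ accessible G S f a K) (hzA : f z ∈ accessible G S f a K)
    (hzy : IsSolo G S f z y) (hc : c ∈ accessible G S f a K)
    (hcz : c ≠ f z) (hm : IsMovable G S f z c) (hp : MovePath G S f a (K.erase (f z)) c) :
    ∃ p, IsEquitableOn G (insert y {v ∈ S | f v ∈ accessible G S f a K})
      (accessible G S f a K) s p := by
  obtain ⟨hf1, hf2, hf3⟩ := hf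
  set A := accessible G S f a K with hA
  have hp' : MovePath G S f a (A.erase (f z)) c := hp.restrict fun j hj =>
    mem_erase.2 ⟨(mem_erase.1 hj.mem).1, mem_accessible.2 (hj.mono (erase_subset _ _))⟩
  obtain ⟨g, hg1, hg2, hg3, hg4, hg5⟩ := hp'.shift hf1
  have hgz : g z = f z := hg2 z (by simp)
  have hgA : ∀ v, f v ∈ A → g v ∈ A := by
    intro v hv
    by_cases h : f v ∈ A.erase (f z)
    · exact mem_of_mem_erase (hg3 v h)
    · rwa [hg2 v h]
  have hgA' : ∀ v, f v ∉ A → g v = f v := fun v hv => hg2 v fun h => hv (mem_of_mem_erase h)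
  have hh1 : IsProperOn G S (Function.update g z c) := hg1.update fun w hw hwc =>
    hm w hw (hg4 w hwc)
  set h := Function.update g z c with hh
  have hhz : h z = c := by rw [hh, Function.update_self]
  have hhne : ∀ v, v ≠ z → h v = g v := fun v hv => by rw [hh, Function.update_of_ne hv]
  have hhA : ∀ v, f v ∈ A → h v ∈ A := by
    intro v hv
    by_cases hvz : v = z
    · rw [hvz, hhz]; exact hc
    · rw [hhne v hvz]; exact hgA v hv
  have hyz : y ≠ z := by rintro rfl; exact hyA hzA
  have hy0 : y ∉ ({v ∈ S | f v ∈ A} : Finset α) := fun hy => hyA (mem_filter.1 hy).2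
  refine ⟨Function.update h y (f z), ?_, ?_, ?_⟩
  · refine IsProperOn.update_insert (fun v hv w hw _ _ =>
      hh1 v (mem_filter.1 hv).1 w (mem_filter.1 hw).1) ?_
    intro w hw hwz hadj
    obtain ⟨hwS, hwA⟩ := mem_filter.1 hw
    by_cases hwz' : w = z
    · rw [hwz', hhz] at hwz
      exact hcz hwz
    · rw [hhne w hwz'] at hwz
      by_cases h1 : f w ∈ A.erase (f z)
      · exact (mem_erase.1 (hg3 w h1)).1 hwz
      · rw [hg2 w h1] at hwz
        exact hwz' (hzy.2 w hwS hwz hadj)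
  · intro v hv
    by_cases hvy : v = y
    · rw [hvy, Function.update_self]; exact hzA
    · rw [Function.update_of_ne hvy]
      exact hhA v (mem_filter.1 (mem_of_mem_insert_of_ne hv hvy)).2
  · intro j hj
    have hjb : j ≠ b := by rintro rfl; exact hb (mem_accessible.1 hj)
    have h1 := hf3 j (accessible_subset hj)
    have h2 := hg5 j
    have h3 := card_filter_update hz (f := g) c j
    rw [hgz, ← hh] at h3
    have h4 : #{v ∈ S | h v = j} = #{v ∈ {v ∈ S | f v ∈ A} | h v = j} := by
      rw [filter_filter]
      congr 1
      apply filter_congr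
      intro v _
      constructor
      · intro hv
        refine ⟨?_, hv⟩
        by_contra hvA
        have hvz : v ≠ z := by rintro rfl; exact hvA hzA
        rw [hhne v hvz, hgA' v hvA] at hv
        exact hvA (hv ▸ hj)
      · exact fun h => h.2
    have h5 : #{v ∈ {v ∈ S | f v ∈ A} | Function.update h y (f z) v = j} =
        #{v ∈ {v ∈ S | f v ∈ A} | h v = j} := by
      congr 1
      apply filter_congr
      intro v hv
      rw [Function.update_of_ne (ne_of_mem_of_not_mem hv hy0)]
    rw [if_neg hjb] at h1
    rw [filter_insert, Function.update_self]
    split_ifs with h6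
    · rw [card_insert_of_notMem fun h => hy0 (mem_filter.1 h).1, h5, ← h4]
      rw [if_pos h6.symm] at h3
      omega
    · rw [h5, ← h4]
      rw [if_neg (Ne.symm h6)] at h3
      omega

/-- If a solo vertex `z` of a terminal class has two nonadjacent solo neighbours, then the
colouring can be changed so that more colours become accessible. -/
lemma IsNearlyEquitableOn.exists_of_solo_pair (hf : IsNearlyEquitableOn G S K s f a b)
    (hdeg : ∀ v ∈ S, #{w ∈ S | G.Adj v w} < #K)
    (ha : a ∈ K) (hb : ¬ MovePath G S f a K b) {z y₁ y₂ : α} (hz : z ∈ S) (hy₁ : y₁ ∈ S)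
    (hy₂ : y₂ ∈ S) (hy₁A : f y₁ ∉ accessible G S f a K) (hy₂A : f y₂ ∉ accessible G S f a K)
    (hne : y₁ ≠ y₂) (hadj : ¬ G.Adj y₁ y₂) (hzA : f z ∈ accessible G S f a K)
    (hza : f z ≠ a) (hzy₁ : IsSolo G S f z y₁) (hzy₂ : IsSolo G S f z y₂)
    (hm : ∀ c ∈ accessible G S f a K, c ≠ f z → ¬ IsMovable G S f z c)
    (hp : ∀ c ∈ accessible G S f a K, c ≠ f z → MovePath G S f a (K.erase (f z)) c)
    {g : α → ι} (hg : IsEquitableOn G ({v ∈ S | f v ∉ accessible G S f a K}.erase y₁)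
      (K \ accessible G S f a K) s g) :
    ∃ h, ∃ d ∈ K, IsNearlyEquitableOn G S K s h a d ∧
      accessible G S f a K ⊂ accessible G S h a K := by
  have hKA := card_sdiff_add_card_eq_card (accessible_subset (G := G) (S := S) (f := f) (a := a)
      (K := K))
  obtain ⟨hf1, hf2, hf3⟩ := hf
  obtain ⟨hg1, hg2, hg3⟩ := hg
  have haA : a ∈ accessible G S f a K := mem_accessible.2 (.nil ha)
  have hbA : b ∉ accessible G S f a K := fun h => hb (mem_accessible.1 h)
  have hAK : accessible G S f a K ⊆ K := accessible_subset
  have hmemA : ∀ c, c ∈ accessible G S f a K ↔ MovePath G S f a K c := fun c => mem_accessible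
  set A := accessible G S f a K with hA
  set B := ({v ∈ S | f v ∉ A} : Finset α) with hB
  have hzd : #{w ∈ B.erase y₁ | G.Adj z w} < #(K \ A) := by
    have h1 := card_adj_add_card_adj (f := f) (S := S) (G := G) A z
    have h2 := hdeg z hz
    have h3 : #(A.erase (f z)) ≤ ∑ j ∈ A, #{x ∈ S | f x = j ∧ G.Adj z x} := by
      rw [card_eq_sum_ones]
      refine le_trans (sum_le_sum fun c hc => ?_) (sum_le_sum_of_subset (erase_subset _ A))
      exact one_le_card_of_not_isMovable (hm c (mem_of_mem_erase hc) (ne_of_mem_erase hc))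
    rw [card_erase_of_mem hzA] at h3
    have h4 : #{w ∈ B.erase y₁ | G.Adj z w} < #{w ∈ S | f w ∉ A ∧ G.Adj z w} := by
      refine card_lt_card ((ssubset_iff_of_subset fun w hw => ?_).2 ⟨y₁, ?_, ?_⟩)
      · obtain ⟨hw, hzw⟩ := mem_filter.1 hw
        obtain ⟨hwS, hwA⟩ := mem_filter.1 (mem_of_mem_erase hw)
        exact mem_filter.2 ⟨hwS, hwA, hzw⟩
      · exact mem_filter.2 ⟨hy₁, hy₁A, hzy₁.1.symm⟩
      · simp
    have := card_pos.2 ⟨_, hzA⟩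
    omega
  obtain ⟨d, hd, hdm⟩ := exists_isMovable (f := g) hzd
  obtain ⟨hdK, hdA⟩ := mem_sdiff.1 hd
  have hyz : y₁ ≠ z := by rintro rfl; exact hy₁A hzA
  have hyz₂ : y₂ ≠ z := by rintro rfl; exact hy₂A hzA
  have hgA : ∀ v ∈ B.erase y₁, g v ∉ A := fun v hv => (mem_sdiff.1 (hg2 v hv)).2
  let S₁ : Finset α := insert y₁ ({v ∈ S | f v ∈ A}.erase z)
  have hS₁ : S₁ ∪ B.erase y₁ = S.erase z := by
    ext v
    simp only [S₁, hB, mem_union, mem_insert, mem_erase, mem_filter]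
    constructor
    · rintro ((rfl | ⟨h1, h2, h3⟩) | ⟨h1, h2, h3⟩)
      · exact ⟨hyz, hy₁⟩
      · exact ⟨h1, h2⟩
      · exact ⟨by rintro rfl; exact h3 hzA, h2⟩
    · rintro ⟨h1, h2⟩
      by_cases h3 : v = y₁
      · exact .inl (.inl h3)
      · by_cases h4 : f v ∈ A
        · exact .inl (.inr ⟨h1, h2, h4⟩)
        · exact .inr ⟨h3, h2, h4⟩
  let p : α → ι := Function.update f y₁ (f z)
  have hp1 : IsProperOn G S₁ p := by
    refine IsProperOn.update_insert (fun v hv w hw _ _ =>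
      hf1 v (mem_filter.1 (mem_of_mem_erase hv)).1 w (mem_filter.1 (mem_of_mem_erase hw)).1) ?_
    intro w hw hwz hadj
    obtain ⟨hwz', hw⟩ := mem_erase.1 hw
    exact hwz' (hzy₁.2 w (mem_filter.1 hw).1 hwz hadj)
  have hpA : ∀ v ∈ S₁, p v ∈ A := by
    intro v hv
    by_cases hvy : v = y₁
    · simp only [p, hvy, Function.update_self]; exact hzA
    · simp only [p, Function.update_of_ne hvy]
      exact (mem_filter.1 (mem_of_mem_erase (mem_of_mem_insert_of_ne hv hvy))).2
  have hq := hp1.glue hg1 hpA hgA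
  rw [hS₁] at hq
  set q : α → ι := fun v => if v ∈ B.erase y₁ then g v else p v with hqdef
  have hh1 : IsProperOn G S (Function.update q z d) := by
    rw [← insert_erase hz]
    refine IsProperOn.update_insert (fun v hv w hw _ _ => hq v hv w hw) ?_
    intro w hw hwd
    rw [← hS₁] at hw
    by_cases hwB : w ∈ B.erase y₁
    · rw [hqdef] at hwd
      simp only [if_pos hwB] at hwd
      exact hdm w hwB hwd
    · rw [hqdef] at hwd
      simp only [if_neg hwB] at hwd
      exact absurd (hwd ▸ hpA w ((mem_union.1 hw).resolve_right hwB)) hdA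
  set h := Function.update q z d with hh
  have hhz : h z = d := Function.update_self ..
  have hhy : h y₁ = f z := by
    simp [hh, hqdef, p, Function.update_of_ne hyz]
  have hhB : ∀ v ∈ B.erase y₁, h v = g v := by
    intro v hv
    have hvz : v ≠ z := by
      rintro rfl; exact (mem_filter.1 (mem_of_mem_erase hv)).2 hzA
    rw [hh, Function.update_of_ne hvz, hqdef]
    simp only [if_pos hv]
  have hhA : ∀ v, f v ∈ A → v ≠ z → h v = f v := by
    intro v hv hvz
    have hvB : v ∉ B.erase y₁ := fun h => (mem_filter.1 (mem_of_mem_erase h)).2 hv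
    have hvy : v ≠ y₁ := by rintro rfl; exact hy₁A hv
    rw [hh, Function.update_of_ne hvz, hqdef]
    simp only [if_neg hvB, p, Function.update_of_ne hvy]
  have hcases : ∀ v ∈ S, v = z ∨ v = y₁ ∨ v ∈ B.erase y₁ ∨ (f v ∈ A ∧ v ≠ z) := by
    intro v hv
    by_cases h1 : v = z
    · exact .inl h1
    by_cases h2 : v = y₁
    · exact .inr (.inl h2)
    by_cases h3 : f v ∈ A
    · exact .inr (.inr (.inr ⟨h3, h1⟩))
    · exact .inr (.inr (.inl (mem_erase.2 ⟨h2, mem_filter.2 ⟨hv, h3⟩⟩)))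
  have hcls : ∀ v ∈ S, ∀ j ∈ A.erase (f z), h v = j ↔ f v = j := by
    intro v hv j hj
    obtain ⟨hjz, hjA⟩ := mem_erase.1 hj
    rcases hcases v hv with rfl | rfl | hv' | ⟨h1, h2⟩
    · rw [hhz]
      exact ⟨fun h => absurd (h ▸ hjA) hdA, fun h => absurd h.symm hjz⟩
    · rw [hhy]
      exact ⟨fun h => absurd h.symm hjz, fun h => absurd (h ▸ hjA) hy₁A⟩
    · rw [hhB v hv']
      exact ⟨fun h => absurd (h ▸ hjA) (hgA v hv'),
        fun h => absurd (h ▸ hjA) (mem_filter.1 (mem_of_mem_erase hv')).2⟩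
    · rw [hhA v h1 h2]
  have hclsz : ({v ∈ S | h v = f z} : Finset α) = insert y₁ ({v ∈ S | f v = f z}.erase z) := by
    ext v
    simp only [mem_filter, mem_insert, mem_erase]
    constructor
    · rintro ⟨hv, hvz⟩
      rcases hcases v hv with rfl | rfl | hv' | ⟨h1, h2⟩
      · rw [hhz] at hvz
        exact absurd (hvz ▸ hzA) hdA
      · exact .inl rfl
      · rw [hhB v hv'] at hvz
        exact absurd (hvz ▸ hzA) (hgA v hv')
      · rw [hhA v h1 h2] at hvz
        exact .inr ⟨h2, hv, hvz⟩
    · rintro (rfl | ⟨h1, h2, h3⟩)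
      · exact ⟨hy₁, hhy⟩
      · exact ⟨h2, by rw [hhA v (h3 ▸ hzA) h1, h3]⟩
  have hclsB : ∀ j ∈ K \ A, ({v ∈ S.erase z | h v = j} : Finset α) =
      {v ∈ B.erase y₁ | g v = j} := by
    intro j hj
    have hjA := (mem_sdiff.1 hj).2
    ext v
    simp only [mem_filter]
    constructor
    · rintro ⟨hv, hvj⟩
      obtain ⟨hvz, hv⟩ := mem_erase.1 hv
      rcases hcases v hv with rfl | rfl | hv' | ⟨h1, h2⟩
      · exact absurd rfl hvz
      · rw [hhy] at hvj
        exact absurd (hvj ▸ hzA) hjA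
      · exact ⟨hv', by rw [← hhB v hv', hvj]⟩
      · rw [hhA v h1 h2] at hvj
        exact absurd (hvj ▸ h1) hjA
    · rintro ⟨hv, hvj⟩
      exact ⟨hS₁ ▸ mem_union_right _ hv, by rw [hhB v hv, hvj]⟩
  refine ⟨h, d, hdK, ⟨hh1, ?_, ?_⟩, ?_⟩
  · intro v hv
    rcases hcases v hv with rfl | rfl | hv' | ⟨h1, h2⟩
    · rwa [hhz]
    · rw [hhy]; exact hAK hzA
    · rw [hhB v hv']; exact (mem_sdiff.1 (hg2 v hv')).1
    · rw [hhA v h1 h2]; exact hAK h1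
  · intro j hj
    by_cases hjA : j ∈ A
    · have hjd : j ≠ d := by rintro rfl; exact hdA hjA
      have hjb : j ≠ b := by rintro rfl; exact hbA hjA
      have h1 := hf3 j hj
      rw [if_neg hjb] at h1
      rw [if_neg hjd, ← h1]
      congr 1
      by_cases hjz : j = f z
      · subst hjz
        have hy0 : y₁ ∉ ({v ∈ S | f v = f z}.erase z : Finset α) := fun hy =>
          hy₁A ((mem_filter.1 (mem_of_mem_erase hy)).2 ▸ hzA)
        have hz0 : z ∈ ({v ∈ S | f v = f z} : Finset α) := mem_filter.2 ⟨hz, rfl⟩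
        rw [hclsz, card_insert_of_notMem hy0, card_erase_add_one hz0]
      · congr 1
        exact filter_congr fun v hv => hcls v hv j (mem_erase.2 ⟨hjz, hjA⟩)
    · have hja : j ≠ a := by rintro rfl; exact hjA haA
      have hjB : j ∈ K \ A := mem_sdiff.2 ⟨hj, hjA⟩
      rw [if_neg hja, add_zero, ← hg3 j hjB, ← hclsB j hjB]
      nth_rw 1 [← insert_erase hz]
      rw [filter_insert, hhz]
      by_cases hjd : j = d
      · rw [if_pos hjd, if_pos hjd.symm, card_insert_of_notMem (by simp)]
      · rw [if_neg hjd, if_neg (Ne.symm hjd), add_zero]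
  · have hpath : ∀ c ∈ A, c ≠ f z → MovePath G S h a (K.erase (f z)) c := by
      intro c hc hcz
      have h1 : MovePath G S f a (A.erase (f z)) c := (hp c hc hcz).restrict fun j hj =>
        mem_erase.2 ⟨(mem_erase.1 hj.mem).1, (hmemA j).2 (hj.mono (erase_subset _ _))⟩
      exact (h1.congr hcls).mono (erase_subset_erase _ hAK)
    have hcz : MovePath G S h a K (f z) := by
      have h1 := (hmemA _).1 hzA
      have h2 : ∃ v c, v ∈ S ∧ f v = f z ∧ IsMovable G S f v c ∧ c ∈ A ∧ c ≠ f z := by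
        generalize hw : f z = w at h1 hza
        cases h1 with
        | nil => exact absurd rfl hza
        | cons v c _ hv hfv hvm hpc =>
          exact ⟨v, c, hv, hfv, hvm, (hmemA c).2 (hpc.mono (erase_subset _ _)),
            (mem_erase.1 hpc.mem).1⟩
      obtain ⟨v, c, hv, hfv, hvm, hcA, hcz⟩ := h2
      have hvz : v ≠ z := by rintro rfl; exact hm c hcA hcz hvm
      refine .cons v c (hAK hzA) hv (by rw [hhA v (hfv ▸ hzA) hvz, hfv]) ?_ (hpath c hcA hcz)
      intro w hw hwc
      exact hvm w hw ((hcls w hw c (mem_erase.2 ⟨hcz, hcA⟩)).1 hwc)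
    have hy₂B : y₂ ∈ B.erase y₁ := mem_erase.2 ⟨hne.symm, mem_filter.2 ⟨hy₂, hy₂A⟩⟩
    have hhy₂ : h y₂ ∈ K \ A := by rw [hhB y₂ hy₂B]; exact hg2 y₂ hy₂B
    refine (ssubset_iff_of_subset fun c hc => ?_).2 ⟨h y₂, ?_, (mem_sdiff.1 hhy₂).2⟩
    · by_cases h1 : c = f z
      · rw [h1]; exact mem_accessible.2 hcz
      · exact mem_accessible.2 ((hpath c hc h1).mono (erase_subset _ _))
    · refine mem_accessible.2 (hcz.step hy₂ (mem_sdiff.1 hhy₂).1 fun w hw hwz hyw => ?_)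
      have hw' : w ∈ ({v ∈ S | h v = f z} : Finset α) := mem_filter.2 ⟨hw, hwz⟩
      rw [hclsz] at hw'
      rcases mem_insert.1 hw' with rfl | hw'
      · exact hadj hyw.symm
      · obtain ⟨hwz', hw'⟩ := mem_erase.1 hw'
        exact hwz' (hzy₂.2 w hw (mem_filter.1 hw').2 hyw)

lemma IsNearlyEquitableOn.exists_isEquitableOn (hdeg : ∀ v ∈ S, #{w ∈ S | G.Adj v w} < #K)
    (hind : ∀ K' ⊂ K, ∀ S' : Finset α, #S' = #K' * s →
      (∀ v ∈ S', #{w ∈ S' | G.Adj v w} < #K') → ∃ g : α → ι, IsEquitableOn G S' K' s g)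
    (ha : a ∈ K) (hbK : b ∈ K) (hf : IsNearlyEquitableOn G S K s f a b) :
    ∃ g, IsEquitableOn G S K s g := by
  induction hN : #(K \ accessible G S f a K) using Nat.strong_induction_on generalizing f b with
  | _ N ih =>
  by_cases hb : MovePath G S f a K b
  · exact hf.exists_of_movePath hb
  have hAK : accessible G S f a K ⊆ K := accessible_subset
  have hcard := hf.card_inaccessible ha hbK hb
  have haA : a ∈ accessible G S f a K := mem_accessible.2 (.nil ha)
  have hex : ∀ y ∈ S, f y ∉ accessible G S f a K →
      ∃ g : α → ι, IsEquitableOn G ({v ∈ S | f v ∉ accessible G S f a K}.erase y)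
        (K \ accessible G S f a K) s g := by
    intro y hy hyA
    refine hind _ (sdiff_ssubset hAK ⟨a, haA⟩) _ ?_ fun v hv => ?_
    · rw [card_erase_of_mem (mem_filter.2 ⟨hy, hyA⟩), hcard, Nat.add_sub_cancel]
    · obtain ⟨hvS, hvA⟩ := mem_filter.1 (mem_of_mem_erase hv)
      refine lt_of_le_of_lt (card_le_card fun w hw => ?_)
        (card_adj_inaccessible_lt hf.2.1 hdeg hvS hvA)
      obtain ⟨hw, hvw⟩ := mem_filter.1 hw
      obtain ⟨hwS, hwA⟩ := mem_filter.1 (mem_of_mem_erase hw)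
      exact mem_filter.2 ⟨hwS, hwA, hvw⟩
  obtain ⟨T, hTA, hTne, haT, hterm, u, huA, huT, hu⟩ :=
    exists_terminal ha (hf.exists_accessible_ne ha hbK hb hdeg)
  by_cases H : ∃ z ∈ S, f z ∈ T ∧ ∃ y ∈ S, f y ∉ accessible G S f a K ∧ IsSolo G S f z y ∧
      ∃ c ∈ accessible G S f a K, c ≠ f z ∧ IsMovable G S f z c
  · obtain ⟨z, hz, hzT, y, hy, hyA, hzy, c, hc, hcz, hm⟩ := H
    obtain ⟨p, hp⟩ := hf.exists_of_isMovable hb hz hyA (hTA hzT) hzy hc hcz hm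
      (hterm _ hzT c hc hcz)
    obtain ⟨g, hg⟩ := hex y hy hyA
    have hdisj : Disjoint (insert y {v ∈ S | f v ∈ accessible G S f a K})
        ({v ∈ S | f v ∉ accessible G S f a K}.erase y) := by
      rw [disjoint_left]
      intro v hv hv'
      obtain ⟨hvy, hv'⟩ := mem_erase.1 hv'
      exact (mem_filter.1 hv').2 (mem_filter.1 (mem_of_mem_insert_of_ne hv hvy)).2
    have hunion : insert y {v ∈ S | f v ∈ accessible G S f a K} ∪
        ({v ∈ S | f v ∉ accessible G S f a K}.erase y) = S := by
      ext v
      by_cases hvy : v = y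
      · simp [hvy, hy]
      · simp only [mem_union, mem_insert, mem_filter, mem_erase, hvy]
        tauto
    exact ⟨_, hunion ▸ hp.glue hg hAK hdisj⟩
  · push Not at H
    have hs : ∀ w ∈ T, #{v ∈ S | f v = w} = s := by
      intro w hw
      have h1 := hf.2.2 w (hAK (hTA hw))
      rwa [if_neg (ne_of_mem_of_not_mem hw haT),
        if_neg (by rintro rfl; exact hb (mem_accessible.1 (hTA hw)))] at h1
    obtain ⟨z, hz, hzT, y₁, hy₁, y₂, hy₂, hy₁A, hy₂A, hne, hadj, hzy₁, hzy₂⟩ :=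
      exists_solo_pair hf.2.1 hAK hTA hTne hdeg
        (fun y hy hyA c hc => not_isMovable_accessible hf.2.1 hy hyA hc) hu hcard hs H
    obtain ⟨g, hg⟩ := hex y₁ hy₁ hy₁A
    obtain ⟨h, d, hd, hh, hlt⟩ := hf.exists_of_solo_pair hdeg ha hb hz hy₁ hy₂ hy₁A hy₂A hne hadj
      (hTA hzT) (ne_of_mem_of_not_mem hzT haT) hzy₁ hzy₂ (H z hz hzT y₁ hy₁ hy₁A hzy₁)
      (hterm _ hzT) hg
    refine ih _ ?_ hd hh rfl
    rw [← hN]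
    have h1 := card_sdiff_add_card_eq_card hAK
    have h2 := card_sdiff_add_card_eq_card (accessible_subset (G := G) (S := S) (f := h) (a := a)
      (K := K))
    have h3 := card_lt_card hlt
    omega

end Near

lemma exists_balanced [Nonempty ι] (s : ℕ) (K : Finset ι) (S : Finset α) (hS : #S = #K * s) :
    ∃ f : α → ι, (∀ v ∈ S, f v ∈ K) ∧ ∀ j ∈ K, #{v ∈ S | f v = j} = s := by
  induction K using Finset.induction_on generalizing S with
  | empty =>
    have : S = ∅ := by simpa using hS
    exact ⟨fun _ => Classical.arbitrary ι, by simp [this], by simp⟩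
  | insert c K hc ih =>
    rw [card_insert_of_notMem hc, add_mul, one_mul] at hS
    obtain ⟨R, hRS, hR⟩ := exists_subset_card_eq (s := S) (n := s) (by omega)
    obtain ⟨f, hf1, hf2⟩ := ih (S \ R) (by rw [card_sdiff_of_subset hRS]; omega)
    refine ⟨fun v => if v ∈ R then c else f v, fun v hv => ?_, fun j hj => ?_⟩
    · dsimp only
      split_ifs with h
      · exact mem_insert_self _ _
      · exact mem_insert_of_mem (hf1 v (mem_sdiff.2 ⟨hv, h⟩))
    · by_cases hjc : j = c
      · rw [← hR]
        congr 1
        ext v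
        simp only [mem_filter]
        constructor
        · rintro ⟨hv, hvj⟩
          by_contra h
          rw [if_neg h] at hvj
          exact hc (hjc ▸ hvj ▸ hf1 v (mem_sdiff.2 ⟨hv, h⟩))
        · intro hv
          exact ⟨hRS hv, by rw [if_pos hv, hjc]⟩
      · rw [← hf2 j (mem_of_mem_insert_of_ne hj hjc)]
        congr 1
        ext v
        simp only [mem_filter, mem_sdiff]
        constructor
        · rintro ⟨hv, hvj⟩
          by_cases h : v ∈ R
          · rw [if_pos h] at hvj
            exact absurd hvj.symm hjc
          · rw [if_neg h] at hvj
            exact ⟨⟨hv, h⟩, hvj⟩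
        · rintro ⟨⟨hv, h⟩, hvj⟩
          exact ⟨hv, by rw [if_neg h, hvj]⟩

/-- The subgraph of the edges with both ends in `T`. -/
def restrictGraph (G : SimpleGraph α) (T : Finset α) : SimpleGraph α where
  Adj v w := G.Adj v w ∧ v ∈ T ∧ w ∈ T
  symm := ⟨fun _ _ h => ⟨h.1.symm, h.2.2, h.2.1⟩⟩
  loopless := ⟨fun _ h => h.1.ne rfl⟩

/-- The **Hajnal–Szemerédi theorem**. -/
theorem exists_isEquitableOn [Nonempty ι] (s : ℕ) (K : Finset ι) (G : SimpleGraph α)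
    (S : Finset α) (hS : #S = #K * s) (hdeg : ∀ v ∈ S, #{w ∈ S | G.Adj v w} < #K) :
    ∃ g : α → ι, IsEquitableOn G S K s g := by
  induction K using Finset.strongInduction generalizing G S with
  | _ K ihK =>
  suffices h : ∀ T : Finset α, ∃ g : α → ι, IsEquitableOn (restrictGraph G T) S K s g by
    obtain ⟨g, hg1, hg2⟩ := h S
    exact ⟨g, fun v hv w hw hvw hadj => hg1 v hv w hw hvw ⟨hadj, hv, hw⟩, hg2⟩
  intro T
  induction T using Finset.induction_on with
  | empty =>
    obtain ⟨f, hf1, hf2⟩ := exists_balanced s K S hS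
    exact ⟨f, fun v _ w _ _ hadj => absurd hadj.2.1 (by simp), hf1, hf2⟩
  | insert u T hu ihT =>
    obtain ⟨f, hf1, hf2, hf3⟩ := ihT
    have hadj : ∀ v w, v ≠ u → w ≠ u → (restrictGraph G (insert u T)).Adj v w →
        (restrictGraph G T).Adj v w := fun v w hv hw h =>
      ⟨h.1, mem_of_mem_insert_of_ne h.2.1 hv, mem_of_mem_insert_of_ne h.2.2 hw⟩
    by_cases huS : u ∈ S
    · have hdeg' : ∀ v ∈ S, #{w ∈ S | (restrictGraph G (insert u T)).Adj v w} < #K :=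
        fun v hv => lt_of_le_of_lt
          (card_le_card (monotone_filter_right _ fun w _ h => h.1)) (hdeg v hv)
      obtain ⟨d, hd, hdm⟩ := exists_isMovable (f := f) (hdeg' u huS)
      refine IsNearlyEquitableOn.exists_isEquitableOn (f := Function.update f u d) (a := f u)
        (b := d) hdeg' (fun K' hK' S' => ihK K' hK' _ S') (hf2 u huS) hd ⟨?_, ?_, ?_⟩
      · rw [← insert_eq_self.2 huS]
        exact IsProperOn.update_insert (fun v hv w hw hvu hwu hvw h =>
          hf1 v hv w hw hvw (hadj v w hvu hwu h)) hdm
      · intro v hv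
        by_cases hvu : v = u
        · rw [hvu, Function.update_self]; exact hd
        · rw [Function.update_of_ne hvu]; exact hf2 v hv
      · intro j hj
        rw [card_filter_update huS, hf3 j hj]
    · exact ⟨f, fun v hv w hw hvw h => hf1 v hv w hw hvw (hadj v w
        (ne_of_mem_of_not_mem hv huS) (ne_of_mem_of_not_mem hw huS) h), hf2, hf3⟩

end EquitableColouring

section MatchingDecomposition

open Finset

variable {k r n : ℕ}

open Classical in
/-- If the `r`-graph `R` has no `k` pairwise disjoint edges, then it has density at most
`(k - 1) / m` as soon as there are `m` pairwise disjoint `r`-sets. -/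
lemma mul_card_le_of_forall_not_isMatchingSet {R : Finset (Finset (Fin n))} {m : ℕ}
    (hR : ∀ e ∈ R, #e = r) (hk : 1 ≤ k) (hr : 1 ≤ r) (hm : r * m ≤ n)
    (hno : ∀ p ⊆ R, ¬ IsMatchingSet k p) : m * #R ≤ (k - 1) * n.choose r := by
  have hblock : ∃ B : Fin m → Finset (Fin n), (∀ i, #(B i) = r) ∧
      ∀ i j, i ≠ j → Disjoint (B i) (B j) := by
    have hlt : ∀ (i : Fin m) (x : Fin r), i.1 * r + x.1 < n := by
      intro i x
      have h1 := x.2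
      have h2 : (i.1 + 1) * r ≤ m * r := Nat.mul_le_mul_right _ i.2
      nlinarith
    refine ⟨fun i => univ.image fun x : Fin r => (⟨i.1 * r + x.1, hlt i x⟩ : Fin n),
      fun i => ?_, fun i j hij => ?_⟩
    · rw [card_image_of_injective, card_univ, Fintype.card_fin]
      intro x y hxy
      simp only [Fin.mk.injEq] at hxy
      ext
      omega
    · rw [disjoint_left]
      simp only [mem_image, mem_univ, true_and]
      rintro _ ⟨x, rfl⟩ ⟨y, hy⟩
      simp only [Fin.mk.injEq] at hy
      apply hij
      ext
      have h1 : (j.1 * r + y.1) / r = (i.1 * r + x.1) / r := by rw [hy]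
      rw [Nat.add_comm, Nat.add_mul_div_right _ _ (by omega), Nat.div_eq_of_lt y.2,
        Nat.add_comm (i.1 * r), Nat.add_mul_div_right _ _ (by omega), Nat.div_eq_of_lt x.2] at h1
      omega
  obtain ⟨B, hBr, hBd⟩ := hblock
  have htrans : ∀ e f : Finset (Fin n), #e = #f → ∃ σ : Equiv.Perm (Fin n),
      e.map σ.toEmbedding = f := by
    intro e f hef
    refine ⟨(Finset.equivOfCardEq hef).extendSubtype, ?_⟩
    refine eq_of_subset_of_card_le ?_ (by rw [card_map, hef])
    intro x hx
    obtain ⟨y, hy, rfl⟩ := mem_map.1 hx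
    exact (Finset.equivOfCardEq hef).extendSubtype_mem y hy
  let N : Finset (Fin n) → Finset (Fin n) → ℕ := fun e f =>
    #{σ : Equiv.Perm (Fin n) | e.map σ.toEmbedding = f}
  have hN1 : ∀ e f g : Finset (Fin n), #f = #g → N e f = N e g := by
    intro e f g hfg
    obtain ⟨τ, hτ⟩ := htrans f g hfg
    refine card_equiv (Equiv.mulLeft τ) fun σ => ?_
    simp only [mem_filter, mem_univ, true_and, Equiv.coe_mulLeft]
    have : e.map (τ * σ).toEmbedding = (e.map σ.toEmbedding).map τ.toEmbedding := by
      rw [map_map]; rfl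
    rw [this, ← hτ, (map_injective _).eq_iff]
  have hcount : ∀ e : Finset (Fin n), #e = r → ∀ f : Finset (Fin n), #f = r →
      n.choose r * N e f = Fintype.card (Equiv.Perm (Fin n)) := by
    intro e he f hf
    rw [← card_univ, card_eq_sum_card_fiberwise (s := univ)
      (f := fun σ : Equiv.Perm (Fin n) => e.map σ.toEmbedding) (t := powersetCard r univ)]
    · rw [sum_congr rfl fun g hg => (hN1 e g f ((mem_powersetCard.1 hg).2.trans hf.symm)),
        sum_const, card_powersetCard, card_univ, Fintype.card_fin, smul_eq_mul]
    · intro σ _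
      simp [he]
  have hle : ∀ σ : Equiv.Perm (Fin n), #{i | (B i).map σ.toEmbedding ∈ R} ≤ k - 1 := by
    intro σ
    by_contra hcon
    let I : Finset (Fin m) := {i | (B i).map σ.toEmbedding ∈ R}
    obtain ⟨J, hJI, hJ⟩ := exists_subset_card_eq (s := I) (n := k) (by
      change k ≤ #{i | (B i).map σ.toEmbedding ∈ R}; omega)
    have hdisj : ∀ i j, i ≠ j →
        Disjoint ((B i).map σ.toEmbedding) ((B j).map σ.toEmbedding) := fun i j hij =>
      (disjoint_map _).2 (hBd i j hij)
    have hinj : Function.Injective fun i => (B i).map σ.toEmbedding := by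
      intro i j hij
      by_contra hne
      have h1 := hdisj i j hne
      dsimp only at hij
      rw [← hij, disjoint_self, bot_eq_empty, map_eq_empty] at h1
      have := hBr i
      rw [h1, card_empty] at this
      omega
    refine hno (J.image fun i => (B i).map σ.toEmbedding) ?_ ⟨?_, ?_⟩
    · intro e he
      obtain ⟨i, hi, rfl⟩ := mem_image.1 he
      exact (mem_filter.1 (hJI hi)).2
    · rw [card_image_of_injective _ hinj, hJ]
    · intro e he f hf hef
      obtain ⟨i, hi, rfl⟩ := mem_image.1 he
      obtain ⟨j, hj, rfl⟩ := mem_image.1 hf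
      exact hdisj i j fun h => hef (by rw [h])
  have hsum : ∑ i : Fin m, ∑ f ∈ R, N (B i) f ≤
      Fintype.card (Equiv.Perm (Fin n)) * (k - 1) := by
    have h1 : ∀ i : Fin m, ∑ f ∈ R, N (B i) f =
        ∑ σ : Equiv.Perm (Fin n), if (B i).map σ.toEmbedding ∈ R then 1 else 0 := by
      intro i
      rw [← card_filter, card_eq_sum_card_fiberwise
        (s := {σ : Equiv.Perm (Fin n) | (B i).map σ.toEmbedding ∈ R})
        (f := fun σ : Equiv.Perm (Fin n) => (B i).map σ.toEmbedding) (t := R)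
        (fun σ hσ => (mem_filter.1 hσ).2)]
      refine sum_congr rfl fun f hf => ?_
      rw [filter_filter]
      change #{σ : Equiv.Perm (Fin n) | (B i).map σ.toEmbedding = f} = _
      congr 1
      refine filter_congr fun σ _ => ⟨fun h => ⟨h ▸ hf, h⟩, fun h => h.2⟩
    rw [sum_congr rfl fun i _ => h1 i, sum_comm, ← card_univ, ← smul_eq_mul]
    refine sum_le_card_nsmul _ _ _ fun σ _ => ?_
    rw [← card_filter]
    exact hle σ
  have hmul : n.choose r * ∑ i : Fin m, ∑ f ∈ R, N (B i) f =
      m * #R * Fintype.card (Equiv.Perm (Fin n)) := by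
    rw [mul_sum, sum_congr rfl fun i _ => by
      rw [mul_sum, sum_congr rfl fun f hf => hcount (B i) (hBr i) f (hR f hf)]]
    simp [mul_assoc]
  have hpos : 0 < Fintype.card (Equiv.Perm (Fin n)) := Fintype.card_pos
  refine Nat.le_of_mul_le_mul_right ?_ hpos
  rw [← hmul]
  calc n.choose r * _ ≤ n.choose r * (Fintype.card (Equiv.Perm (Fin n)) * (k - 1)) :=
        Nat.mul_le_mul_left _ hsum
    _ = _ := by ring

lemma card_filter_mem_le {G : Finset (Finset (Fin n))} (hG : ∀ e ∈ G, #e = r) (v : Fin n) :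
    #{e ∈ G | v ∈ e} ≤ (n - 1).choose (r - 1) := by
  have h1 : #(powersetCard (r - 1) ((univ : Finset (Fin n)).erase v)) =
      (n - 1).choose (r - 1) := by
    rw [card_powersetCard, card_erase_of_mem (mem_univ v), card_univ, Fintype.card_fin]
  rw [← h1]
  refine card_le_card_of_injOn (fun e => e.erase v) (fun e he => ?_) fun e he f hf hef => ?_
  · obtain ⟨he, hv⟩ := mem_filter.1 he
    rw [mem_coe, mem_powersetCard]
    exact ⟨erase_subset_erase _ (subset_univ _), by rw [card_erase_of_mem hv, hG e he]⟩
  · rw [← insert_erase (mem_filter.1 he).2, ← insert_erase (mem_filter.1 hf).2]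
    exact congrArg _ hef

lemma card_biUnion_id {M : Finset (Finset (Finset (Fin n)))}
    (hM : ∀ p ∈ M, ∀ q ∈ M, p ≠ q → Disjoint p q) (hMk : ∀ p ∈ M, IsMatchingSet k p) :
    #(M.biUnion id) = k * #M := by
  rw [card_biUnion (t := id) hM, mul_comm, ← smul_eq_mul]
  exact sum_eq_card_nsmul fun p hp => (hMk p hp).1

/-- A family of `t` edge-disjoint copies of `H` in `G` yields a decomposition of `G`. -/
lemma phiM_le_of_pairwise_disjoint {G : Finset (Finset (Fin n))}
    {M : Finset (Finset (Finset (Fin n)))}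
    (hM : ∀ p ∈ M, ∀ q ∈ M, p ≠ q → Disjoint p q) (hMG : ∀ p ∈ M, p ⊆ G)
    (hMk : ∀ p ∈ M, IsMatchingSet k p) :
    k * #M ≤ #G ∧ phiM k G ≤ #M + (#G - k * #M) := by
  have hcard : #(M.biUnion id) = k * #M := card_biUnion_id hM hMk
  have hsub : M.biUnion id ⊆ G := biUnion_subset.2 hMG
  refine ⟨hcard ▸ card_le_card hsub, ?_⟩
  let Q : Finset (Finset (Finset (Fin n))) := (G \ M.biUnion id).image fun e => {e}
  have hQ : #Q ≤ #G - k * #M := by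
    rw [← hcard, ← card_sdiff_of_subset hsub]
    exact card_image_le
  have hPcard : #(M ∪ Q) ≤ #M + (#G - k * #M) := (card_union_le _ _).trans (by omega)
  suffices hdec : IsMatchingDecomp k G (M ∪ Q) from
    le_trans (Nat.sInf_le ⟨M ∪ Q, hdec, rfl⟩) hPcard
  refine ⟨?_, ?_, ?_⟩
  · have hMQ : ∀ p ∈ M, ∀ q ∈ Q, Disjoint p q := by
      intro p hp q hq
      obtain ⟨e, he, rfl⟩ := mem_image.1 hq
      rw [disjoint_singleton_right]
      exact fun hep => (mem_sdiff.1 he).2 (mem_biUnion.2 ⟨p, hp, hep⟩)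
    intro p hp q hq hpq
    rcases mem_union.1 hp with hp | hp <;> rcases mem_union.1 hq with hq | hq
    · exact hM p hp q hq hpq
    · exact hMQ p hp q hq
    · exact (hMQ q hq p hp).symm
    · obtain ⟨e, he, rfl⟩ := mem_image.1 hp
      obtain ⟨f, hf, rfl⟩ := mem_image.1 hq
      rw [disjoint_singleton]
      exact fun h => hpq (by rw [h])
  · rw [union_biUnion]
    have : Q.biUnion id = G \ M.biUnion id := by
      ext e
      simp [Q]
    rw [this, union_sdiff_of_subset hsub]
  · intro p hp
    rcases mem_union.1 hp with hp | hp
    · exact .inr (hMk p hp)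
    · obtain ⟨e, _, rfl⟩ := mem_image.1 hp
      exact .inl ⟨e, rfl⟩

lemma exists_phiM_eq (k : ℕ) (G : Finset (Finset (Fin n))) :
    ∃ P, IsMatchingDecomp k G P ∧ #P = phiM k G := by
  refine Nat.sInf_mem (s := {m | ∃ P, IsMatchingDecomp k G P ∧ P.card = m})
    ⟨_, G.image fun e => {e}, ⟨?_, ?_, ?_⟩, rfl⟩
  · intro p hp q hq hpq
    obtain ⟨e, he, rfl⟩ := mem_image.1 hp
    obtain ⟨f, hf, rfl⟩ := mem_image.1 hq
    rw [disjoint_singleton]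
    exact fun h => hpq (by rw [h])
  · ext e
    simp
  · intro p hp
    obtain ⟨e, _, rfl⟩ := mem_image.1 hp
    exact .inl ⟨e, rfl⟩

lemma div_add_mod_le_phiM (hk : 1 ≤ k) (G : Finset (Finset (Fin n))) :
    #G / k + #G % k ≤ phiM k G := by
  obtain ⟨P, ⟨hP1, hP2, hP3⟩, hP⟩ := exists_phiM_eq k G
  rw [← hP]
  have hG : #G = ∑ p ∈ P, #p := by
    rw [← hP2, card_biUnion (t := id) hP1]
    rfl
  have h1 : ∑ p ∈ P, #p = ∑ p ∈ P with #p = k, #p + ∑ p ∈ P with ¬ #p = k, #p :=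
    (sum_filter_add_sum_filter_not _ _ _).symm
  have h2 : ∑ p ∈ P with #p = k, #p = #{p ∈ P | #p = k} * k := by
    rw [← smul_eq_mul]
    exact sum_eq_card_nsmul fun p hp => (mem_filter.1 hp).2
  have h3 : ∑ p ∈ P with ¬ #p = k, #p = #{p ∈ P | ¬ #p = k} * 1 := by
    rw [← smul_eq_mul]
    refine sum_eq_card_nsmul fun p hp => ?_
    obtain ⟨hp, hpk⟩ := mem_filter.1 hp
    rcases hP3 p hp with ⟨e, rfl⟩ | h
    · simp
    · exact absurd h.1 hpk
  have h4 := card_filter_add_card_filter_not (s := P) (fun p => #p = k)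
  have h5 : #{p ∈ P | #p = k} ≤ #G / k := by
    rw [Nat.le_div_iff_mul_le (by omega)]
    omega
  have h6 := Nat.div_add_mod #G k
  nlinarith [Nat.mul_le_mul_right (k - 1) h5, Nat.sub_add_cancel hk]

/-- Two distinct edges are adjacent in the conflict graph if they meet. -/
def conflictGraph (n : ℕ) : SimpleGraph (Finset (Fin n)) where
  Adj e f := e ≠ f ∧ ¬ Disjoint e f
  symm := ⟨fun _ _ h => ⟨h.1.symm, fun h' => h.2 h'.symm⟩⟩
  loopless := ⟨fun _ h => h.1 rfl⟩

open Classical in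
lemma card_conflictGraph_adj_lt {G : Finset (Finset (Fin n))} (hG : ∀ e ∈ G, #e = r) (hr : 1 ≤ r)
    {e : Finset (Fin n)} (he : e ∈ G) :
    #{f ∈ G | (conflictGraph n).Adj e f} < r * (n - 1).choose (r - 1) := by
  have h1 : #(e.biUnion fun v => {f ∈ G | v ∈ f}) ≤ r * (n - 1).choose (r - 1) := by
    rw [← hG e he]
    refine card_biUnion_le_card_mul _ _ _ fun v _ => ?_
    rw [hG e he]
    exact card_filter_mem_le hG v
  refine lt_of_lt_of_le (card_lt_card ((ssubset_iff_of_subset fun f hf => ?_).2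
    ⟨e, ?_, ?_⟩)) h1
  · obtain ⟨hf, hadj⟩ := mem_filter.1 hf
    obtain ⟨v, hve, hvf⟩ := not_disjoint_iff.1 hadj.2
    exact mem_biUnion.2 ⟨v, hve, mem_filter.2 ⟨hf, hvf⟩⟩
  · obtain ⟨v, hv⟩ : e.Nonempty := card_pos.1 (by rw [hG e he]; omega)
    exact mem_biUnion.2 ⟨v, hv, mem_filter.2 ⟨he, hv⟩⟩
  · simp

open Classical in
/-- An `r`-graph with sufficiently many edges has an optimal decomposition. -/
lemma phiM_le_div_add_mod {G : Finset (Finset (Fin n))} (hG : ∀ e ∈ G, #e = r) (hk : 1 ≤ k)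
    (hr : 1 ≤ r) (hq : r * (n - 1).choose (r - 1) ≤ #G / k) :
    phiM k G ≤ #G / k + #G % k := by
  have hdm := Nat.div_add_mod #G k
  obtain ⟨S, hSG, hS⟩ := exists_subset_card_eq (s := G) (n := #G / k * k)
    (Nat.div_mul_le_self _ _)
  obtain ⟨g, hg1, hg2, hg3⟩ := exists_isEquitableOn k (range (#G / k)) (conflictGraph n) S
    (by rw [hS, card_range]) fun e he => by
      rw [card_range]
      refine lt_of_lt_of_le (lt_of_le_of_lt (card_le_card (filter_subset_filter _ hSG))
        (card_conflictGraph_adj_lt hG hr (hSG he))) hq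
  let c : ℕ → Finset (Finset (Fin n)) := fun j => {e ∈ S | g e = j}
  have hc : ∀ i ∈ range (#G / k), #(c i) = k := fun i hi => by convert hg3 i hi
  have hdisj : ∀ i j, i ≠ j → Disjoint (c i) (c j) := by
    intro i j hij
    rw [disjoint_left]
    intro e he he'
    exact hij ((mem_filter.1 he).2.symm.trans (mem_filter.1 he').2)
  have hcard : #((range (#G / k)).image c) = #G / k := by
    rw [card_image_of_injOn, card_range]
    intro i hi j hj hij
    by_contra hne
    have h1 := hdisj i j hne
    rw [← hij, disjoint_self, bot_eq_empty] at h1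
    have := hc i hi
    rw [h1, card_empty] at this
    omega
  obtain ⟨-, h⟩ := phiM_le_of_pairwise_disjoint (M := (range (#G / k)).image c) (G := G)
    (by
      intro p hp q hq hpq
      obtain ⟨i, _, rfl⟩ := mem_image.1 hp
      obtain ⟨j, _, rfl⟩ := mem_image.1 hq
      exact hdisj i j fun h => hpq (by rw [h]))
    (by
      intro p hp
      obtain ⟨i, _, rfl⟩ := mem_image.1 hp
      exact (filter_subset _ _).trans hSG)
    (by
      intro p hp
      obtain ⟨i, hi, rfl⟩ := mem_image.1 hp
      refine ⟨hc i hi, fun e he f hf hef => ?_⟩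
      obtain ⟨he, hei⟩ := mem_filter.1 he
      obtain ⟨hf, hfi⟩ := mem_filter.1 hf
      by_contra hcon
      exact hg1 e he f hf (hei.trans hfi.symm) ⟨hef, hcon⟩)
  rw [hcard] at h
  omega

/-- Greedily removing copies of `H`. -/
lemma exists_phiM_le_greedy {G : Finset (Finset (Fin n))} (hG : ∀ e ∈ G, #e = r) (hk : 1 ≤ k)
    (hr : 1 ≤ r) {m : ℕ} (hm : r * m ≤ n) :
    ∃ t ρ, #G = k * t + ρ ∧ m * ρ ≤ (k - 1) * n.choose r ∧ phiM k G ≤ t + ρ := by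
  classical
  let F : Finset (Finset (Finset (Finset (Fin n)))) :=
    {M | (∀ p ∈ M, ∀ q ∈ M, p ≠ q → Disjoint p q) ∧ (∀ p ∈ M, p ⊆ G) ∧
      ∀ p ∈ M, IsMatchingSet k p}
  have hF : F.Nonempty := ⟨∅, by simp [F]⟩
  obtain ⟨M, hM, hmax⟩ := exists_max_image F card hF
  obtain ⟨-, hM1, hM2, hM3⟩ := mem_filter.1 hM
  obtain ⟨h1, h2⟩ := phiM_le_of_pairwise_disjoint hM1 hM2 hM3
  refine ⟨#M, #G - k * #M, by omega, ?_, h2⟩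
  have hcard : #(M.biUnion id) = k * #M := card_biUnion_id hM1 hM3
  have hsub : M.biUnion id ⊆ G := biUnion_subset.2 hM2
  rw [← hcard, ← card_sdiff_of_subset hsub]
  refine mul_card_le_of_forall_not_isMatchingSet (fun e he => hG e (mem_sdiff.1 he).1) hk hr hm ?_
  intro p hp hpk
  have hpM : ∀ q ∈ M, Disjoint p q := by
    intro q hq
    rw [disjoint_left]
    exact fun e hep heq => (mem_sdiff.1 (hp hep)).2 (mem_biUnion.2 ⟨q, hq, heq⟩)
  have hpnot : p ∉ M := by
    intro h
    have h0 := hpM p h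
    rw [disjoint_self, bot_eq_empty] at h0
    have := hpk.1
    rw [h0, card_empty] at this
    omega
  have := hmax (insert p M) (mem_filter.2 ⟨mem_univ _, ?_, ?_, ?_⟩)
  · rw [card_insert_of_notMem hpnot] at this
    omega
  · intro q hq q' hq' hne
    rcases mem_insert.1 hq with hqp | hqM <;>
      rcases mem_insert.1 hq' with hqp' | hqM'
    · exact absurd (hqp.trans hqp'.symm) hne
    · exact hqp ▸ hpM q' hqM'
    · exact hqp' ▸ (hpM q hqM).symm
    · exact hM1 q hqM q' hqM' hne
  · intro q hq
    rcases mem_insert.1 hq with rfl | hq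
    · exact hp.trans sdiff_subset
    · exact hM2 q hq
  · intro q hq
    rcases mem_insert.1 hq with rfl | hq
    · exact hpk
    · exact hM3 q hq

/-- The upper bound for `φ_H^r(G)` for an arbitrary `r`-graph `G`. -/
lemma phiM_le (hk : 1 ≤ k) (hr : 2 ≤ r) (hn : k * r * (k + r - 2) + 2 * r - 1 ≤ n)
    {G : Finset (Finset (Fin n))} (hG : ∀ e ∈ G, #e = r) :
    phiM k G ≤ n.choose r / k ∨ phiM k G ≤ #G / k + #G % k := by
  obtain ⟨l, rfl⟩ : ∃ l, k = l + 1 := ⟨k - 1, by omega⟩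
  obtain ⟨m, hmdef⟩ : ∃ m, m = (l + 1) * r + l ^ 2 := ⟨_, rfl⟩
  have hm : r * m ≤ n := by
    obtain ⟨x, rfl⟩ : ∃ x, r = x + 2 := ⟨r - 2, by omega⟩
    refine le_trans ?_ hn
    rw [show l + 1 + (x + 2) - 2 = l + 1 + x by omega]
    apply Nat.le_sub_of_add_le
    rw [hmdef]
    nlinarith
  obtain ⟨t, ρ, h1, h2, h3⟩ := exists_phiM_le_greedy (k := l + 1) hG hk (by omega) hm
  rw [Nat.add_sub_cancel] at h2
  by_cases hcase : #G + l * ρ ≤ n.choose r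
  · left
    rw [Nat.le_div_iff_mul_le (by omega)]
    nlinarith [Nat.mul_le_mul_right (l + 1) h3]
  · right
    refine phiM_le_div_add_mod hG hk (by omega) ?_
    rw [Nat.le_div_iff_mul_le (by omega)]
    push Not at hcase
    have hnd : n * (n - 1).choose (r - 1) = n.choose r * r := by
      obtain ⟨n', rfl⟩ : ∃ n', n = n' + 1 := ⟨n - 1, by omega⟩
      obtain ⟨r', rfl⟩ : ∃ r', r = r' + 1 := ⟨r - 1, by omega⟩
      exact Nat.add_one_mul_choose_eq n' r'
    set C := n.choose r
    set d := (n - 1).choose (r - 1)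
    have hmpos : 0 < m := by rw [hmdef]; nlinarith
    have h4 : r * (m * d) ≤ r * C := by
      calc r * (m * d) = r * m * d := by ring
        _ ≤ n * d := Nat.mul_le_mul_right _ hm
        _ = r * C := by rw [hnd, mul_comm]
    have h5 : m * d ≤ C := Nat.le_of_mul_le_mul_left h4 (by omega)
    refine Nat.le_of_mul_le_mul_left ?_ hmpos
    have h6 : m * C ≤ m * #G + l * (l * C) := by
      calc m * C ≤ m * (#G + l * ρ) := Nat.mul_le_mul_left _ hcase.le
        _ = m * #G + l * (m * ρ) := by ring
        _ ≤ _ := by gcongr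
    have h7 : m * C = (l + 1) * r * C + l * (l * C) := by rw [hmdef]; ring
    calc m * (r * d * (l + 1)) = (l + 1) * r * (m * d) := by ring
      _ ≤ (l + 1) * r * C := Nat.mul_le_mul_left _ h5
      _ ≤ m * #G := by omega

lemma card_le_choose {G : Finset (Finset (Fin n))} (hG : ∀ e ∈ G, #e = r) :
    #G ≤ n.choose r := by
  calc #G ≤ #(powersetCard r (univ : Finset (Fin n))) :=
        card_le_card fun e he => mem_powersetCard.2 ⟨subset_univ _, hG e he⟩
    _ = n.choose r := by rw [card_powersetCard, card_univ, Fintype.card_fin]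

/-- The maximum of `N / k + N % k` over all `N ≤ C`. -/
lemma div_add_mod_le_ite (hk : 1 ≤ k) {N C : ℕ} (h : N ≤ C) :
    N / k + N % k ≤ if C % k = k - 1 then C / k + (k - 1) else C / k + (k - 2) := by
  have h1 := Nat.mod_lt N hk
  have h2 := Nat.mod_lt C hk
  have h3 := Nat.div_le_div_right (c := k) h
  split_ifs with h4
  · omega
  · rcases h3.eq_or_lt with h5 | h5
    · have h6 := Nat.div_add_mod N k
      have h7 := Nat.div_add_mod C k
      rw [h5] at h6
      omega
    · omega

end MatchingDecomposition

/-- If `k ≥ 1`, `r ≥ 2`, `n ≥ kr(k+r-2) + 2r - 1`, and `H` is the `r`-graph consisting of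
exactly `k` pairwise disjoint edges, then `φ_H^r(n) = ⌊C(n,r)/k⌋ + k - 1` if
`C(n,r) ≡ k - 1 (mod k)`, and `φ_H^r(n) = ⌊C(n,r)/k⌋ + k - 2` otherwise. -/
theorem phiMMax_eq (k r n : ℕ) (hk : 1 ≤ k) (hr : 2 ≤ r)
    (hn : k * r * (k + r - 2) + 2 * r - 1 ≤ n) :
    phiMMax r k n =
      if n.choose r % k = k - 1 then n.choose r / k + (k - 1)
      else n.choose r / k + (k - 2) := by
  have hub : ∀ G : Finset (Finset (Fin n)), (∀ e ∈ G, e.card = r) → phiM k G ≤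
      if n.choose r % k = k - 1 then n.choose r / k + (k - 1)
      else n.choose r / k + (k - 2) := by
    intro G hG
    rcases phiM_le hk hr hn hG with h | h
    · refine h.trans ?_
      split_ifs <;> omega
    · exact h.trans (div_add_mod_le_ite hk (card_le_choose hG))
  have hN : ∃ N ≤ n.choose r, N / k + N % k =
      if n.choose r % k = k - 1 then n.choose r / k + (k - 1)
      else n.choose r / k + (k - 2) := by
    split_ifs with h
    · exact ⟨_, le_rfl, by rw [h]⟩
    · have hk2 : 2 ≤ k := by
        by_contra hk2
        obtain rfl : k = 1 := by omega
        exact h (Nat.mod_one _)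
      have hkC : k ≤ n.choose r := by
        have h1 : k * r ≤ k * r * (k + r - 2) := Nat.le_mul_of_pos_right _ (by omega)
        have h2 : k ≤ k * r := Nat.le_mul_of_pos_right _ (by omega)
        obtain ⟨n', rfl⟩ : ∃ n', n = n' + 1 := ⟨n - 1, by omega⟩
        obtain ⟨r', rfl⟩ : ∃ r', r = r' + 1 := ⟨r - 1, by omega⟩
        have h3 : 0 < n'.choose r' := Nat.choose_pos (by omega)
        refine Nat.le_of_mul_le_mul_right (c := r' + 1) ?_ (by omega)
        rw [← Nat.add_one_mul_choose_eq]
        exact le_trans (by omega) (Nat.le_mul_of_pos_right _ h3)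
      obtain ⟨q, hq⟩ : ∃ q, n.choose r / k = q + 1 :=
        ⟨n.choose r / k - 1, by have := Nat.div_pos hkC hk; omega⟩
      have h4 := Nat.div_add_mod (n.choose r) k
      rw [hq, mul_add, mul_one] at h4
      refine ⟨k * q + (k - 1), by omega, ?_⟩
      rw [Nat.mul_add_div hk, Nat.mul_add_mod, Nat.mod_eq_of_lt (by omega),
        Nat.div_eq_of_lt (by omega), hq]
      omega
  obtain ⟨N, hNC, hN⟩ := hN
  obtain ⟨G, hGsub, hGN⟩ := Finset.exists_subset_card_eq
    (s := Finset.powersetCard r (Finset.univ : Finset (Fin n))) (n := N)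
    (by rwa [Finset.card_powersetCard, Finset.card_univ, Fintype.card_fin])
  have hG : ∀ e ∈ G, e.card = r := fun e he => (Finset.mem_powersetCard.1 (hGsub he)).2
  refine IsGreatest.csSup_eq ⟨⟨G, hG, le_antisymm (hub G hG) ?_⟩, ?_⟩
  · rw [← hN, ← hGN]
    exact div_add_mod_le_phiM hk G
  · rintro _ ⟨G', hG', rfl⟩
    exact hub G' hG'
end
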